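/- For any nonzero integer n and appropriate z, the n-fold iterate of the map z ↦ z/(2z+1) applied to the k=2 transformation gives ψ_2(z/(2nz+1)) = (1/(2nz+1)) ψ_2(z) + (nz(3z² + 4nz + 2)/(2nz+1)²) · π²/6. -/

import Mathlib

namespace RothThm

open MvPolynomial

/-- Polynomials in countably many variables over the reals. -/
abbrev MP := MvPolynomial ℕ ℝ

/-- monomial evaluated at `ρ`. -/
noncomputable def mon (ρ : ℕ → ℝ) (I : ℕ →₀ ℕ) : ℝ := I.prod (fun j a => ρ j ^ a)

lemma mon_add (ρ : ℕ → ℝ) (I J : ℕ →₀ ℕ) : mon ρ (I + J) = mon ρ I * mon ρ J := by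
  unfold mon
  exact Finsupp.prod_add_index' (by simp) (fun a b c => pow_add _ _ _)

lemma mon_zero (ρ : ℕ → ℝ) : mon ρ 0 = 1 := by simp [mon]

lemma mon_single (ρ : ℕ → ℝ) (j a : ℕ) : mon ρ (Finsupp.single j a) = ρ j ^ a := by
  simp [mon]

lemma mon_nonneg {ρ : ℕ → ℝ} (h : ∀ j, 0 ≤ ρ j) (I : ℕ →₀ ℕ) : 0 ≤ mon ρ I :=
  Finset.prod_nonneg (fun j _ => pow_nonneg (h j) _)

lemma mon_pos {ρ : ℕ → ℝ} (h : ∀ j, 0 < ρ j) (I : ℕ →₀ ℕ) : 0 < mon ρ I :=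
  Finset.prod_pos (fun j _ => pow_pos (h j) _)

lemma mon_one (I : ℕ →₀ ℕ) : mon (fun _ => 1) I = 1 := by simp [mon]

lemma mon_eq_prod_range (ρ : ℕ → ℝ) (I : ℕ →₀ ℕ) (n : ℕ) (h : ∀ j, n ≤ j → I j = 0) :
    mon ρ I = ∏ j ∈ Finset.range n, ρ j ^ I j := by
  unfold mon
  apply Finsupp.prod_of_support_subset
  · intro j hj
    rw [Finsupp.mem_support_iff] at hj
    by_contra hc
    exact hj (h j (by simpa using hc))
  · simp

/-- weighted L1 norm -/
noncomputable def wN (ρ : ℕ → ℝ) (P : MP) : ℝ := ∑ I ∈ P.support, |P.coeff I| * mon ρ I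

lemma wN_eq_of_subset (ρ : ℕ → ℝ) (P : MP) (s : Finset (ℕ →₀ ℕ)) (h : P.support ⊆ s) :
    wN ρ P = ∑ I ∈ s, |P.coeff I| * mon ρ I := by
  unfold wN
  apply Finset.sum_subset h
  intro I _ hI
  rw [notMem_support_iff.mp hI]; simp

lemma wN_nonneg {ρ : ℕ → ℝ} (h : ∀ j, 0 ≤ ρ j) (P : MP) : 0 ≤ wN ρ P :=
  Finset.sum_nonneg fun I _ => mul_nonneg (abs_nonneg _) (mon_nonneg h I)

lemma coeff_le_wN {ρ : ℕ → ℝ} (h : ∀ j, 0 ≤ ρ j) (P : MP) (I : ℕ →₀ ℕ) :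
    |P.coeff I| * mon ρ I ≤ wN ρ P := by
  classical
  rw [wN_eq_of_subset ρ P (insert I P.support) (Finset.subset_insert _ _)]
  exact Finset.single_le_sum (f := fun I => |P.coeff I| * mon ρ I)
    (fun J _ => mul_nonneg (abs_nonneg _) (mon_nonneg h J)) (Finset.mem_insert_self _ _)

lemma wN_add_le {ρ : ℕ → ℝ} (h : ∀ j, 0 ≤ ρ j) (P Q : MP) : wN ρ (P + Q) ≤ wN ρ P + wN ρ Q := by
  classical
  have h1 : (P + Q).support ⊆ P.support ∪ Q.support := support_add
  rw [wN_eq_of_subset ρ _ _ h1, wN_eq_of_subset ρ P _ Finset.subset_union_left,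
    wN_eq_of_subset ρ Q _ Finset.subset_union_right, ← Finset.sum_add_distrib]
  apply Finset.sum_le_sum
  intro I _
  rw [coeff_add, ← add_mul]
  exact mul_le_mul_of_nonneg_right (abs_add_le _ _) (mon_nonneg h I)

lemma wN_zero (ρ : ℕ → ℝ) : wN ρ 0 = 0 := by simp [wN]

lemma wN_sum_le {ρ : ℕ → ℝ} (h : ∀ j, 0 ≤ ρ j) {ι : Type*} (s : Finset ι) (f : ι → MP) :
    wN ρ (∑ i ∈ s, f i) ≤ ∑ i ∈ s, wN ρ (f i) := by
  classical
  induction s using Finset.induction_on with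
  | empty => simp [wN_zero]
  | insert a s ha ih =>
    rw [Finset.sum_insert ha, Finset.sum_insert ha]
    exact (wN_add_le h _ _).trans (by gcongr)

lemma wN_monomial (ρ : ℕ → ℝ) (I : ℕ →₀ ℕ) (c : ℝ) : wN ρ (monomial I c) = |c| * mon ρ I := by
  rw [wN_eq_of_subset ρ _ {I} support_monomial_subset]
  simp

lemma wN_C (ρ : ℕ → ℝ) (c : ℝ) : wN ρ (C c) = |c| := by
  have := wN_monomial ρ 0 c
  rw [mon_zero, mul_one] at this
  exact this

lemma wN_one (ρ : ℕ → ℝ) : wN ρ 1 = 1 := by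
  have := wN_C ρ 1
  simpa using this

lemma wN_X (ρ : ℕ → ℝ) (j : ℕ) : wN ρ (X j) = ρ j := by
  have := wN_monomial ρ (Finsupp.single j 1) 1
  rw [mon_single] at this
  simpa [X] using this

lemma wN_neg (ρ : ℕ → ℝ) (P : MP) : wN ρ (-P) = wN ρ P := by
  simp [wN, support_neg]

lemma wN_mul_le {ρ : ℕ → ℝ} (h : ∀ j, 0 ≤ ρ j) (P Q : MP) : wN ρ (P * Q) ≤ wN ρ P * wN ρ Q := by
  have e : P * Q = ∑ I ∈ P.support, ∑ J ∈ Q.support,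
      monomial (I + J) (P.coeff I * Q.coeff J) := by
    conv_lhs => rw [P.as_sum, Q.as_sum, Finset.sum_mul_sum]
    simp [monomial_mul]
  rw [e]
  refine (wN_sum_le h _ _).trans ?_
  unfold wN
  rw [Finset.sum_mul_sum]
  refine Finset.sum_le_sum fun I _ => ?_
  refine (wN_sum_le h _ _).trans ?_
  refine Finset.sum_le_sum fun J _ => ?_
  rw [wN_monomial, mon_add, abs_mul]
  apply le_of_eq; ring

lemma wN_prod_le {ρ : ℕ → ℝ} (h : ∀ j, 0 ≤ ρ j) {ι : Type*} (s : Finset ι) (f : ι → MP) :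
    wN ρ (∏ i ∈ s, f i) ≤ ∏ i ∈ s, wN ρ (f i) := by
  classical
  induction s using Finset.induction_on with
  | empty => simp [wN_one]
  | insert a s ha ih =>
    rw [Finset.prod_insert ha, Finset.prod_insert ha]
    exact (wN_mul_le h _ _).trans (mul_le_mul_of_nonneg_left ih (wN_nonneg h _))

lemma wN_pow_le {ρ : ℕ → ℝ} (h : ∀ j, 0 ≤ ρ j) (P : MP) (n : ℕ) :
    wN ρ (P ^ n) ≤ wN ρ P ^ n := by
  have := wN_prod_le h (Finset.range n) (fun _ => P)
  simpa using this

/-- translation -/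
noncomputable def T (β : ℕ → ℝ) : MP →ₐ[ℝ] MP := aeval (fun j => X j + C (β j))

lemma T_X (β : ℕ → ℝ) (j : ℕ) : T β (X j) = X j + C (β j) := by simp [T]
lemma T_C (β : ℕ → ℝ) (c : ℝ) : T β (C c) = C c := by
  simp [T]

lemma T_T (β γ : ℕ → ℝ) (P : MP) : T γ (T β P) = T (β + γ) P := by
  have : (T γ).comp (T β) = T (β + γ) := by
    apply MvPolynomial.algHom_ext
    intro j
    simp [T_X, T_C]
    ring
  rw [← this]; rfl

lemma T_zero (P : MP) : T 0 P = P := by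
  have : T 0 = AlgHom.id ℝ MP := by
    apply MvPolynomial.algHom_ext
    intro j
    simp [T_X]
  rw [this]; rfl

lemma T_injective (β : ℕ → ℝ) : Function.Injective (T β) := by
  intro P Q h
  have := congrArg (T (-β)) h
  rwa [T_T, T_T, add_neg_cancel, T_zero, T_zero] at this

lemma T_ne_zero (β : ℕ → ℝ) {P : MP} (h : P ≠ 0) : T β P ≠ 0 := by
  intro h0
  exact h (T_injective β (by rw [h0, map_zero]))

lemma T_monomial (β : ℕ → ℝ) (I : ℕ →₀ ℕ) (c : ℝ) :
    T β (monomial I c) = C c * ∏ j ∈ I.support, (X j + C (β j)) ^ I j := by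
  unfold T
  rw [aeval_monomial, MvPolynomial.algebraMap_eq]
  rfl

lemma wN_T_le {ρ : ℕ → ℝ} (h : ∀ j, 0 ≤ ρ j) (γ : ℕ → ℝ) (P : MP) :
    wN ρ (T γ P) ≤ wN (fun j => ρ j + |γ j|) P := by
  conv_lhs => rw [P.as_sum, map_sum]
  refine (wN_sum_le h _ _).trans ?_
  unfold wN
  refine Finset.sum_le_sum fun I _ => ?_
  change wN ρ _ ≤ _
  rw [T_monomial]
  refine (wN_mul_le h _ _).trans ?_
  rw [wN_C]
  refine mul_le_mul_of_nonneg_left ?_ (abs_nonneg _)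
  refine (wN_prod_le h _ _).trans ?_
  unfold mon Finsupp.prod
  refine Finset.prod_le_prod (fun j _ => wN_nonneg h _) fun j _ => ?_
  refine (wN_pow_le h _ _).trans ?_
  refine pow_le_pow_left₀ (wN_nonneg h _) ?_ _
  refine (wN_add_le h _ _).trans ?_
  rw [wN_X, wN_C]

lemma pderiv_T (β : ℕ → ℝ) (i : ℕ) (P : MP) : pderiv i (T β P) = T β (pderiv i P) := by
  classical
  induction P using MvPolynomial.induction_on with
  | C a => simp [T_C]
  | add p q hp hq => simp [hp, hq]
  | mul_X p j hp =>
    rw [map_mul, pderiv_mul, pderiv_mul, map_add, map_mul, map_mul, hp, T_X]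
    congr 1
    rw [map_add, pderiv_C, add_zero, pderiv_X]
    by_cases hij : j = i
    · subst hij; simp
    · simp [Pi.single_apply, hij]

/-- multi-factorial -/
noncomputable def fct (I : ℕ →₀ ℕ) : ℝ := I.prod (fun _ a => (a.factorial : ℝ))

lemma fct_pos (I : ℕ →₀ ℕ) : 0 < fct I :=
  Finset.prod_pos fun j _ => by positivity

lemma fct_eq (I : ℕ →₀ ℕ) (s : Finset ℕ) (h : I.support ⊆ s) :
    fct I = ∏ j ∈ s, ((I j).factorial : ℝ) := by
  unfold fct
  exact Finsupp.prod_of_support_subset _ h _ (by simp)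

lemma fct_add_single (I : ℕ →₀ ℕ) (i : ℕ) :
    fct (I + Finsupp.single i 1) = (I i + 1) * fct I := by
  classical
  rw [fct_eq (I + Finsupp.single i 1) (insert i I.support)
    (by intro j hj; simp at hj ⊢; by_cases hji : j = i; · exact Or.inl hji
        · right; simpa [Finsupp.single_apply, Ne.symm hji] using hj),
    fct_eq I (insert i I.support) (Finset.subset_insert _ _)]
  have hi : i ∈ insert i I.support := Finset.mem_insert_self _ _
  rw [← Finset.mul_prod_erase _ _ hi, ← Finset.mul_prod_erase _ _ hi, ← mul_assoc]
  congr 1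
  · simp [Nat.factorial_succ]
  · apply Finset.prod_congr rfl
    intro j hj
    have : j ≠ i := (Finset.mem_erase.mp hj).1
    simp [Finsupp.single_apply, Ne.symm this]

/-- multi-binomial `(J+I)!/(J! I!)` -/
noncomputable def bin (J I : ℕ →₀ ℕ) : ℝ := fct (J + I) / (fct J * fct I)

lemma bin_pos (J I : ℕ →₀ ℕ) : 0 < bin J I :=
  div_pos (fct_pos _) (mul_pos (fct_pos _) (fct_pos _))

lemma bin_zero (J : ℕ →₀ ℕ) : bin J 0 = 1 := by
  unfold bin
  have h0 : fct 0 = 1 := by simp [fct]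
  rw [add_zero, h0, mul_one, div_self (fct_pos J).ne']

lemma bin_eq (J I : ℕ →₀ ℕ) :
    bin J I = ((∏ j ∈ (J + I).support, Nat.choose (J j + I j) (I j) : ℕ) : ℝ) := by
  have hJ : J.support ⊆ (J + I).support := by
    intro j hj; simp at hj ⊢; omega
  have hI : I.support ⊆ (J + I).support := by
    intro j hj; simp at hj ⊢; omega
  unfold bin
  rw [fct_eq _ _ hJ, fct_eq _ _ hI, fct_eq _ _ subset_rfl, ← Finset.prod_mul_distrib,
    ← Finset.prod_div_distrib]
  push_cast
  apply Finset.prod_congr rfl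
  intro j _
  change (((J j + I j).factorial : ℕ) : ℝ) / _ = _
  rw [Nat.add_choose, Nat.cast_div (Nat.factorial_mul_factorial_dvd_factorial_add _ _)
    (by positivity)]
  push_cast
  rfl

lemma bin_le (J I : ℕ →₀ ℕ) : bin J I ≤ mon (fun _ => 2) (J + I) := by
  rw [bin_eq]
  unfold mon Finsupp.prod
  push_cast
  apply Finset.prod_le_prod
  · intro j _; positivity
  · intro j _
    have := Nat.choose_le_two_pow (J j + I j) (I j)
    change _ ≤ (2 : ℝ) ^ (J j + I j)
    exact_mod_cast this

/-- Hasse derivative -/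
noncomputable def hasse (I : ℕ →₀ ℕ) (P : MP) : MP :=
  ∑ J ∈ P.support, if I ≤ J then monomial (J - I) (bin (J - I) I * P.coeff J) else 0

lemma coeff_hasse (I : ℕ →₀ ℕ) (P : MP) (J : ℕ →₀ ℕ) :
    (hasse I P).coeff J = bin J I * P.coeff (J + I) := by
  classical
  unfold hasse
  rw [coeff_sum]
  rw [Finset.sum_eq_single (J + I)]
  · have : I ≤ J + I := le_add_self
    simp [this, coeff_monomial]
  · intro K _ hK
    split_ifs with h
    · rw [coeff_monomial, if_neg]
      intro h2
      apply hK
      rw [← h2, tsub_add_cancel_of_le h]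
    · simp
  · intro h
    rw [notMem_support_iff.mp h]
    simp

lemma hasse_zero (P : MP) : hasse 0 P = P := by
  ext J
  rw [coeff_hasse, bin_zero, add_zero, one_mul]

lemma pderiv_hasse (I : ℕ →₀ ℕ) (i : ℕ) (P : MP) :
    pderiv i (hasse I P) = C ((I i : ℝ) + 1) * hasse (I + Finsupp.single i 1) P := by
  ext J
  rw [coeff_pderiv, coeff_C_mul, coeff_hasse, coeff_hasse]
  have e : J + (I + Finsupp.single i 1) = J + Finsupp.single i 1 + I := by abel
  rw [e]
  unfold bin
  rw [e, fct_add_single, fct_add_single]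
  have h1 := (fct_pos J).ne'
  have h2 := (fct_pos I).ne'
  have h3 : (J i : ℝ) + 1 ≠ 0 := by positivity
  have h4 : (I i : ℝ) + 1 ≠ 0 := by positivity
  field_simp

lemma hasse_add_single (I : ℕ →₀ ℕ) (i : ℕ) (P : MP) :
    hasse (I + Finsupp.single i 1) P = C (((I i : ℝ) + 1)⁻¹) * pderiv i (hasse I P) := by
  rw [pderiv_hasse, ← mul_assoc, ← C_mul, inv_mul_cancel₀ (by positivity), C_1, one_mul]

/-- induction on multi-indices by adding units -/
lemma ind_single {p : (ℕ →₀ ℕ) → Prop} (h0 : p 0) (h : ∀ I i, p I → p (I + Finsupp.single i 1))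
    (I : ℕ →₀ ℕ) : p I := by
  induction I using Finsupp.induction with
  | zero => exact h0
  | single_add a b f _ _ hf =>
    clear * - hf h
    rw [add_comm]
    induction b with
    | zero => simpa using hf
    | succ b ih =>
      rw [Finsupp.single_add, ← add_assoc]
      exact h _ _ ih

lemma T_hasse (β : ℕ → ℝ) (I : ℕ →₀ ℕ) (P : MP) : T β (hasse I P) = hasse I (T β P) := by
  induction I using ind_single with
  | h0 => rw [hasse_zero, hasse_zero]
  | h I i ih => rw [hasse_add_single, hasse_add_single, map_mul, T_C, ← pderiv_T, ih]

lemma hasse_sum (I : ℕ →₀ ℕ) {ι : Type*} (s : Finset ι) (f : ι → MP) :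
    hasse I (∑ i ∈ s, f i) = ∑ i ∈ s, hasse I (f i) := by
  ext J
  simp [coeff_hasse, coeff_sum, Finset.mul_sum]

lemma hasse_C_mul (I : ℕ →₀ ℕ) (c : ℝ) (P : MP) : hasse I (C c * P) = C c * hasse I P := by
  ext J
  simp [coeff_hasse, coeff_C_mul]
  ring

/-- coefficients of the translate are values of Hasse derivatives -/
lemma coeff_T (β : ℕ → ℝ) (I : ℕ →₀ ℕ) (P : MP) :
    (T β P).coeff I = ∑ K ∈ (hasse I P).support, (hasse I P).coeff K * mon β K := by
  have h1 : (T β P).coeff I = (hasse I (T β P)).coeff 0 := by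
    rw [coeff_hasse, zero_add]
    have : bin 0 I = 1 := by
      unfold bin
      have h0 : fct 0 = 1 := by simp [fct]
      rw [zero_add, h0, one_mul, div_self (fct_pos I).ne']
    rw [this, one_mul]
  rw [h1, ← T_hasse]
  generalize hasse I P = R
  have h2 : ∀ R : MP, (T β R).coeff 0 = eval β R := by
    intro R
    have : (constantCoeff.comp (T β : MP →+* MP)) = eval β := by
      apply MvPolynomial.ringHom_ext
      · intro r; simp [T_C]
      · intro i; simp [T_X]
    rw [← this]; rfl
  rw [h2, eval_eq]
  rfl

/-- degree bounds -/
def DegLe (r : ℕ → ℕ) (P : MP) : Prop := ∀ I, P.coeff I ≠ 0 → ∀ j, I j ≤ r j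

lemma DegLe.mono {r s : ℕ → ℕ} {P : MP} (h : DegLe r P) (hrs : ∀ j, r j ≤ s j) : DegLe s P :=
  fun I hI j => (h I hI j).trans (hrs j)

lemma DegLe.add {r : ℕ → ℕ} {P Q : MP} (hP : DegLe r P) (hQ : DegLe r Q) : DegLe r (P + Q) := by
  intro I hI j
  rw [coeff_add] at hI
  by_cases h : P.coeff I = 0
  · exact hQ I (by rw [h, zero_add] at hI; exact hI) j
  · exact hP I h j

lemma DegLe.zero (r : ℕ → ℕ) : DegLe r 0 := by intro I hI; simp at hI

lemma DegLe.sum {r : ℕ → ℕ} {ι : Type*} (s : Finset ι) (f : ι → MP)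
    (h : ∀ i ∈ s, DegLe r (f i)) : DegLe r (∑ i ∈ s, f i) :=
  Finset.sum_induction f (DegLe r) (fun _ _ => DegLe.add) (DegLe.zero r) h

lemma exists_of_coeff_mul {P Q : MP} {I : ℕ →₀ ℕ} (h : (P * Q).coeff I ≠ 0) :
    ∃ A B, A + B = I ∧ P.coeff A ≠ 0 ∧ Q.coeff B ≠ 0 := by
  classical
  rw [coeff_mul] at h
  obtain ⟨x, hx, hne⟩ := Finset.exists_ne_zero_of_sum_ne_zero h
  exact ⟨x.1, x.2, Finset.HasAntidiagonal.mem_antidiagonal.mp hx, left_ne_zero_of_mul hne, right_ne_zero_of_mul hne⟩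

lemma DegLe.mul {r s : ℕ → ℕ} {P Q : MP} (hP : DegLe r P) (hQ : DegLe s Q) :
    DegLe (r + s) (P * Q) := by
  intro I hI j
  obtain ⟨A, B, rfl, hA, hB⟩ := exists_of_coeff_mul hI
  exact add_le_add (hP A hA j) (hQ B hB j)

lemma DegLe.C (r : ℕ → ℕ) (c : ℝ) : DegLe r (MvPolynomial.C c) := by
  classical
  intro I hI j
  rw [coeff_C] at hI
  split_ifs at hI with h
  · rw [← h]; simp
  · simp at hI

lemma DegLe.prod {ι : Type*} (s : Finset ι) (r : ι → ℕ → ℕ) (f : ι → MP)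
    (h : ∀ i ∈ s, DegLe (r i) (f i)) : DegLe (∑ i ∈ s, r i) (∏ i ∈ s, f i) := by
  classical
  induction s using Finset.induction_on with
  | empty => simpa using DegLe.C 0 1
  | insert a s ha ih =>
    rw [Finset.prod_insert ha, Finset.sum_insert ha]
    exact (h a (Finset.mem_insert_self _ _)).mul
      (ih fun i hi => h i (Finset.mem_insert_of_mem hi))

lemma DegLe.T {r : ℕ → ℕ} {P : MP} (hP : DegLe r P) (β : ℕ → ℝ) : DegLe r (T β P) := by
  classical
  rw [P.as_sum, map_sum]
  apply DegLe.sum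
  intro I hI
  rw [T_monomial]
  have hX : ∀ j, DegLe (Pi.single j 1) (X j + MvPolynomial.C (β j)) := by
    intro j
    apply DegLe.add _ (DegLe.C _ _)
    intro K hK i
    rw [coeff_X] at hK
    split_ifs at hK with h
    · rw [← h, Finsupp.single_eq_pi_single]
    · simp at hK
  have h2 : ∀ j, DegLe (I j • Pi.single j 1) ((X j + MvPolynomial.C (β j)) ^ I j) := by
    intro j
    have := DegLe.prod (Finset.range (I j)) (fun _ => Pi.single j 1)
      (fun _ => X j + MvPolynomial.C (β j)) (fun _ _ => hX j)
    simpa using this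
  have h3 := (DegLe.C 0 (P.coeff I)).mul (DegLe.prod I.support _ _ (fun j _ => h2 j))
  apply h3.mono
  intro i
  rw [zero_add, Finset.sum_apply]
  refine le_trans ?_ (hP I (mem_support_iff.mp hI) i)
  by_cases hi : i ∈ I.support
  · rw [Finset.sum_eq_single i]
    · simp
    · intro b _ hb; simp [Pi.single_apply, Ne.symm hb]
    · intro h; exact absurd hi h
  · rw [Finset.sum_eq_zero]
    · exact Nat.zero_le _
    · intro b hb
      have : i ≠ b := by rintro rfl; exact hi hb
      simp [Pi.single_apply, this]

lemma DegLe.hasse {r : ℕ → ℕ} {P : MP} (hP : DegLe r P) (I : ℕ →₀ ℕ) : DegLe r (hasse I P) := by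
  intro J hJ j
  rw [coeff_hasse] at hJ
  have := hP _ (right_ne_zero_of_mul hJ) j
  simp only [Finsupp.add_apply] at this
  omega

lemma hasse_eq_zero {r : ℕ → ℕ} {P : MP} (hP : DegLe r P) (I : ℕ →₀ ℕ) (j : ℕ) (h : r j < I j) :
    RothThm.hasse I P = 0 := by
  ext J
  rw [coeff_hasse, coeff_zero]
  by_contra hne
  have := hP _ (right_ne_zero_of_mul hne) j
  simp only [Finsupp.add_apply] at this
  omega

lemma pderiv_eq_zero {r : ℕ → ℕ} {P : MP} (hP : DegLe r P) (j : ℕ) (h : r j = 0) :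
    pderiv j P = 0 := by
  ext J
  rw [coeff_pderiv, coeff_zero]
  by_contra hne
  have := hP _ (left_ne_zero_of_mul hne) j
  simp [h] at this

lemma hasse_mul_of_left {r : ℕ → ℕ} (P : MP) {Q : MP} (hQ : DegLe r Q) (I : ℕ →₀ ℕ)
    (h : ∀ j, I j ≠ 0 → r j = 0) : RothThm.hasse I (P * Q) = RothThm.hasse I P * Q := by
  induction I using ind_single with
  | h0 => rw [hasse_zero, hasse_zero]
  | h I i ih =>
    have hi : r i = 0 := h i (by simp)
    rw [hasse_add_single, hasse_add_single, ih (fun j hj => h j (by simp [hj])), pderiv_mul,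
      pderiv_eq_zero hQ i hi]
    ring

lemma coeff_mul_disjoint {r s : ℕ → ℕ} {P Q : MP} (hP : DegLe r P) (hQ : DegLe s Q)
    (hd : ∀ j, r j = 0 ∨ s j = 0) (I J : ℕ →₀ ℕ) (hI : P.coeff I ≠ 0) (hJ : Q.coeff J ≠ 0) :
    (P * Q).coeff (I + J) = P.coeff I * Q.coeff J := by
  classical
  rw [coeff_mul]
  rw [Finset.sum_eq_single (I, J)]
  · intro x hx hne
    by_contra hc
    apply hne
    have h1 := hP _ (left_ne_zero_of_mul hc)
    have h2 := hQ _ (right_ne_zero_of_mul hc)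
    have h3 := hP _ hI
    have h4 := hQ _ hJ
    have h5 := Finset.HasAntidiagonal.mem_antidiagonal.mp hx
    have key : ∀ j, x.1 j = I j ∧ x.2 j = J j := by
      intro j
      have h6 := DFunLike.congr_fun h5 j
      simp only [Finsupp.add_apply] at h6
      have := h1 j; have := h2 j; have := h3 j; have := h4 j
      rcases hd j with h | h <;> omega
    ext j
    · exact (key j).1
    · exact (key j).2
  · intro h
    apply absurd _ h
    rw [Finset.HasAntidiagonal.mem_antidiagonal]

/-- norm of Hasse derivative -/
lemma wN_hasse_le (I : ℕ →₀ ℕ) (P : MP) :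
    wN (fun _ => 1) (hasse I P) ≤ wN (fun _ => 2) P := by
  classical
  rw [wN, wN]
  have hinj : Set.InjOn (fun J : ℕ →₀ ℕ => J + I) ((hasse I P).support : Set (ℕ →₀ ℕ)) :=
    fun a _ b _ h => add_right_cancel h
  have hsub : (hasse I P).support.image (fun J => J + I) ⊆ P.support := by
    intro K hK
    obtain ⟨J, hJ, rfl⟩ := Finset.mem_image.mp hK
    rw [mem_support_iff, coeff_hasse] at hJ
    exact mem_support_iff.mpr (right_ne_zero_of_mul hJ)
  refine le_trans ?_ (Finset.sum_le_sum_of_subset_of_nonneg hsub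
    (fun K _ _ => mul_nonneg (abs_nonneg _) (mon_nonneg (by norm_num) _)))
  rw [Finset.sum_image hinj]
  refine Finset.sum_le_sum fun J _ => ?_
  rw [coeff_hasse, mon_one, mul_one, abs_mul, abs_of_pos (bin_pos _ _), mul_comm]
  exact mul_le_mul_of_nonneg_left (bin_le J I) (abs_nonneg _)

lemma mon_le_pow {r : ℕ → ℕ} {n : ℕ} (hr : ∀ j, n ≤ j → r j = 0) {c : ℝ} (hc : 1 ≤ c)
    (I : ℕ →₀ ℕ) (hI : ∀ j, I j ≤ r j) :
    mon (fun _ => c) I ≤ c ^ (∑ j ∈ Finset.range n, r j) := by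
  rw [mon_eq_prod_range _ _ n (fun j hj => by have := hI j; rw [hr j hj] at this; omega),
    Finset.prod_pow_eq_pow_sum]
  exact pow_le_pow_right₀ hc (Finset.sum_le_sum fun j _ => hI j)

lemma wN_le_pow_mul {r : ℕ → ℕ} {n : ℕ} (hr : ∀ j, n ≤ j → r j = 0) {c : ℝ} (hc : 1 ≤ c)
    {P : MP} (hP : DegLe r P) :
    wN (fun _ => c) P ≤ c ^ (∑ j ∈ Finset.range n, r j) * wN (fun _ => 1) P := by
  unfold wN
  rw [Finset.mul_sum]
  refine Finset.sum_le_sum fun I hI => ?_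
  rw [mon_one, mul_one, mul_comm]
  exact mul_le_mul_of_nonneg_right (mon_le_pow hr hc I (hP I (mem_support_iff.mp hI))) (abs_nonneg _)

/-- integrality -/
def IsInt (P : MP) : Prop := ∀ I, ∃ z : ℤ, P.coeff I = z

lemma IsInt.add {P Q : MP} (hP : IsInt P) (hQ : IsInt Q) : IsInt (P + Q) := by
  intro I
  obtain ⟨a, ha⟩ := hP I
  obtain ⟨b, hb⟩ := hQ I
  exact ⟨a + b, by rw [coeff_add, ha, hb]; push_cast; ring⟩

lemma IsInt.neg {P : MP} (hP : IsInt P) : IsInt (-P) := by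
  intro I
  obtain ⟨a, ha⟩ := hP I
  exact ⟨-a, by rw [coeff_neg, ha]; push_cast; ring⟩

lemma int_sum {ι : Type*} (s : Finset ι) (f : ι → ℝ) (h : ∀ i ∈ s, ∃ z : ℤ, f i = z) :
    ∃ z : ℤ, ∑ i ∈ s, f i = z :=
  Finset.sum_induction f (fun x => ∃ z : ℤ, x = z)
    (by rintro _ _ ⟨a, rfl⟩ ⟨b, rfl⟩; exact ⟨a + b, by push_cast; ring⟩) ⟨0, by simp⟩ h

lemma IsInt.mul {P Q : MP} (hP : IsInt P) (hQ : IsInt Q) : IsInt (P * Q) := by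
  classical
  intro I
  rw [coeff_mul]
  apply int_sum
  intro x _
  obtain ⟨a, ha⟩ := hP x.1
  obtain ⟨b, hb⟩ := hQ x.2
  exact ⟨a * b, by rw [ha, hb]; push_cast; ring⟩

lemma IsInt.zero : IsInt 0 := fun I => ⟨0, by simp⟩

lemma IsInt.one : IsInt 1 := by
  classical
  intro I
  rw [coeff_one]
  split_ifs
  · exact ⟨1, by simp⟩
  · exact ⟨0, by simp⟩

lemma IsInt.hasse {P : MP} (hP : IsInt P) (I : ℕ →₀ ℕ) : IsInt (RothThm.hasse I P) := by
  intro J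
  obtain ⟨a, ha⟩ := hP (J + I)
  rw [coeff_hasse, ha, bin_eq]
  exact ⟨_, by rw [← Int.cast_natCast, ← Int.cast_mul]⟩

/-- weights -/
noncomputable def wt (w : ℕ → ℝ) (I : ℕ →₀ ℕ) : ℝ := I.sum fun j a => w j * a

lemma wt_add (w : ℕ → ℝ) (I J : ℕ →₀ ℕ) : wt w (I + J) = wt w I + wt w J := by
  unfold wt
  exact Finsupp.sum_add_index' (by simp) (fun a b c => by push_cast; ring)

lemma wt_zero (w : ℕ → ℝ) : wt w 0 = 0 := by simp [wt]

lemma wt_single (w : ℕ → ℝ) (j a : ℕ) : wt w (Finsupp.single j a) = w j * a := by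
  simp [wt]

lemma wt_nonneg {w : ℕ → ℝ} (h : ∀ j, 0 ≤ w j) (I : ℕ →₀ ℕ) : 0 ≤ wt w I :=
  Finset.sum_nonneg fun j _ => mul_nonneg (h j) (by positivity)

lemma wt_eq_sum_range (w : ℕ → ℝ) (I : ℕ →₀ ℕ) (n : ℕ) (h : ∀ j, n ≤ j → I j = 0) :
    wt w I = ∑ j ∈ Finset.range n, w j * I j := by
  unfold wt
  apply Finsupp.sum_of_support_subset
  · intro j hj
    rw [Finsupp.mem_support_iff] at hj
    by_contra hc
    exact hj (h j (by simpa using hc))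
  · simp

/-- weighted order at least `t` -/
def Ord (w : ℕ → ℝ) (t : ℝ) (P : MP) : Prop := ∀ I, P.coeff I ≠ 0 → t ≤ wt w I

lemma Ord.add {w : ℕ → ℝ} {t : ℝ} {P Q : MP} (hP : Ord w t P) (hQ : Ord w t Q) :
    Ord w t (P + Q) := by
  intro I hI
  rw [coeff_add] at hI
  by_cases h : P.coeff I = 0
  · exact hQ I (by rw [h, zero_add] at hI; exact hI)
  · exact hP I h

lemma Ord.neg {w : ℕ → ℝ} {t : ℝ} {P : MP} (hP : Ord w t P) : Ord w t (-P) := by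
  intro I hI
  rw [coeff_neg, neg_ne_zero] at hI
  exact hP I hI

lemma Ord.zero (w : ℕ → ℝ) (t : ℝ) : Ord w t 0 := by intro I hI; simp at hI

lemma Ord.mul {w : ℕ → ℝ} {t s : ℝ} {P Q : MP} (hP : Ord w t P) (hQ : Ord w s Q) :
    Ord w (t + s) (P * Q) := by
  intro I hI
  obtain ⟨A, B, rfl, hA, hB⟩ := exists_of_coeff_mul hI
  rw [wt_add]
  exact add_le_add (hP A hA) (hQ B hB)

lemma Ord.of_nonneg {w : ℕ → ℝ} (h : ∀ j, 0 ≤ w j) (P : MP) : Ord w 0 P :=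
  fun I _ => wt_nonneg h I

lemma Ord.hasse {w : ℕ → ℝ} {t : ℝ} {P : MP} (hP : Ord w t P) (I : ℕ →₀ ℕ) :
    Ord w (t - wt w I) (RothThm.hasse I P) := by
  intro J hJ
  rw [coeff_hasse] at hJ
  have := hP _ (right_ne_zero_of_mul hJ)
  rw [wt_add] at this
  linarith

lemma Ord.prod {w : ℕ → ℝ} (hw : ∀ j, 0 ≤ w j) {ι : Type*} (s : Finset ι) (t : ι → ℝ) (f : ι → MP)
    (h : ∀ i ∈ s, Ord w (t i) (f i)) : Ord w (∑ i ∈ s, t i) (∏ i ∈ s, f i) := by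
  classical
  induction s using Finset.induction_on with
  | empty => simpa using Ord.of_nonneg hw 1
  | insert a s ha ih =>
    rw [Finset.prod_insert ha, Finset.sum_insert ha]
    exact (h a (Finset.mem_insert_self _ _)).mul
      (ih fun i hi => h i (Finset.mem_insert_of_mem hi))

/-- generic determinant induction -/
lemma det_induction {k : ℕ} (M : Matrix (Fin k) (Fin k) MP) (p : MP → Prop)
    (h0 : p 0) (hadd : ∀ a b, p a → p b → p (a + b)) (hneg : ∀ a, p a → p (-a))
    (hprod : ∀ σ : Equiv.Perm (Fin k), p (∏ i, M (σ i) i)) : p M.det := by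
  rw [Matrix.det_apply]
  apply Finset.sum_induction _ p (fun a b => hadd a b) h0
  intro σ _
  rcases Int.units_eq_one_or (Equiv.Perm.sign σ) with h | h
  · rw [h, one_smul]; exact hprod σ
  · rw [h, Units.neg_smul, one_smul]; exact hneg _ (hprod σ)

lemma wN_det_le {k : ℕ} (M : Matrix (Fin k) (Fin k) MP) (B : ℝ)
    (h : ∀ i j, wN (fun _ => 1) (M i j) ≤ B) :
    wN (fun _ => 1) M.det ≤ k.factorial * B ^ k := by
  have hρ : ∀ j : ℕ, (0 : ℝ) ≤ (fun _ => 1) j := fun _ => zero_le_one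
  rw [Matrix.det_apply]
  refine (wN_sum_le hρ _ _).trans ?_
  have : ∀ σ ∈ (Finset.univ : Finset (Equiv.Perm (Fin k))),
      wN (fun _ => 1) (Equiv.Perm.sign σ • ∏ i, M (σ i) i) ≤ B ^ k := by
    intro σ _
    have h1 : wN (fun _ => 1) (Equiv.Perm.sign σ • ∏ i, M (σ i) i) =
        wN (fun _ => 1) (∏ i, M (σ i) i) := by
      rcases Int.units_eq_one_or (Equiv.Perm.sign σ) with h | h
      · rw [h, one_smul]
      · rw [h, Units.neg_smul, one_smul, wN_neg]
    rw [h1]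
    refine (wN_prod_le hρ _ _).trans ?_
    refine (Finset.prod_le_prod (fun i _ => wN_nonneg hρ _) (fun i _ => h (σ i) i)).trans ?_
    simp
  refine (Finset.sum_le_sum this).trans ?_
  simp [Fintype.card_perm]

end RothThm


namespace RothThm
open MvPolynomial

abbrev FF := FractionRing MP

noncomputable def hvec {k : ℕ} (φ : Fin k → MP) (I : ℕ →₀ ℕ) : Fin k → FF :=
  fun l => algebraMap MP FF (hasse I (φ l))

noncomputable def Vs {k : ℕ} (φ : Fin k → MP) (s : ℕ) : Submodule FF (Fin k → FF) :=
  Submodule.span FF {v | ∃ I : ℕ →₀ ℕ, I.degree < s ∧ v = hvec φ I}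

lemma Vs_mono {k : ℕ} (φ : Fin k → MP) (s : ℕ) : Vs φ s ≤ Vs φ (s + 1) := by
  apply Submodule.span_mono
  rintro v ⟨I, hI, rfl⟩
  exact ⟨I, by omega, rfl⟩

/-- the annihilator -/
def Ann {k : ℕ} (φ : Fin k → MP) (s : ℕ) (c : Fin k → MP) : Prop :=
  ∀ I : ℕ →₀ ℕ, I.degree < s → ∑ l, c l * hasse I (φ l) = 0

lemma Ann_succ {k : ℕ} (φ : Fin k → MP) (s : ℕ) (h : Vs φ (s + 1) ≤ Vs φ s) (c : Fin k → MP)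
    (hc : Ann φ s c) : Ann φ (s + 1) c := by
  intro I hI
  have hmem : hvec φ I ∈ Vs φ s := h (Submodule.subset_span ⟨I, hI, rfl⟩)
  have key : ∀ v ∈ Vs φ s, ∑ l, algebraMap MP FF (c l) * v l = 0 := by
    intro v hv
    induction hv using Submodule.span_induction with
    | mem x hx =>
      obtain ⟨J, hJ, rfl⟩ := hx
      have := congrArg (algebraMap MP FF) (hc J hJ)
      rw [map_sum, map_zero] at this
      rw [← this]
      apply Finset.sum_congr rfl
      intro l _
      rw [map_mul]; rfl
    | zero => simp
    | add x y _ _ hx hy =>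
      simp only [Pi.add_apply, mul_add, Finset.sum_add_distrib, hx, hy, add_zero]
    | smul a x _ hx =>
      have : ∑ l, algebraMap MP FF (c l) * (a • x) l = a * ∑ l, algebraMap MP FF (c l) * x l := by
        rw [Finset.mul_sum]
        apply Finset.sum_congr rfl
        intro l _
        simp only [Pi.smul_apply, smul_eq_mul]; ring
      rw [this, hx, mul_zero]
  have h2 := key _ hmem
  apply IsFractionRing.injective MP FF
  rw [map_sum, map_zero, ← h2]
  apply Finset.sum_congr rfl
  intro l _
  rw [map_mul]; rfl

lemma Ann_pderiv {k : ℕ} (φ : Fin k → MP) (s : ℕ) (h : Vs φ (s + 1) ≤ Vs φ s) (c : Fin k → MP)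
    (hc : Ann φ s c) (i : ℕ) : Ann φ s (fun l => pderiv i (c l)) := by
  intro I hI
  have h1 := congrArg (pderiv i) (hc I hI)
  have h2 := Ann_succ φ s h c hc (I + Finsupp.single i 1) (by simp; omega)
  rw [map_sum, map_zero] at h1
  have h3 : ∑ l, pderiv i (c l * hasse I (φ l)) = ∑ l, pderiv i (c l) * hasse I (φ l) +
      C ((I i : ℝ) + 1) * ∑ l, c l * hasse (I + Finsupp.single i 1) (φ l) := by
    rw [Finset.mul_sum, ← Finset.sum_add_distrib]
    apply Finset.sum_congr rfl
    intro l _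
    rw [pderiv_mul, pderiv_hasse]; ring
  rw [h3, h2, mul_zero, add_zero] at h1
  exact h1

lemma Ann_hasse {k : ℕ} (φ : Fin k → MP) (s : ℕ) (h : Vs φ (s + 1) ≤ Vs φ s) (c : Fin k → MP)
    (hc : Ann φ s c) (K : ℕ →₀ ℕ) : Ann φ s (fun l => hasse K (c l)) := by
  induction K using ind_single with
  | h0 => simpa only [hasse_zero] using hc
  | h K i ih =>
    intro I hI
    have h1 := Ann_pderiv φ s h _ ih i I hI
    have h2 : ∑ l, hasse (K + Finsupp.single i 1) (c l) * hasse I (φ l) =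
        C (((K i : ℝ) + 1)⁻¹) * ∑ l, pderiv i (hasse K (c l)) * hasse I (φ l) := by
      rw [Finset.mul_sum]
      apply Finset.sum_congr rfl
      intro l _
      rw [hasse_add_single]; ring
    rw [h2, h1, mul_zero]

lemma Ann_eq_zero {k : ℕ} (φ : Fin k → MP) (hφ : LinearIndependent ℝ φ) (s : ℕ)
    (h : Vs φ (s + 1) ≤ Vs φ s) (c : Fin k → MP) (hc : Ann φ s c) : c = 0 := by
  classical
  by_contra hne
  set S : Finset (ℕ →₀ ℕ) := Finset.univ.biUnion (fun l => (c l).support) with hS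
  have hSne : S.Nonempty := by
    obtain ⟨l, hl⟩ := Function.ne_iff.mp hne
    obtain ⟨J, hJ⟩ := MvPolynomial.ne_zero_iff.mp hl
    exact ⟨J, Finset.mem_biUnion.mpr ⟨l, Finset.mem_univ _, mem_support_iff.mpr hJ⟩⟩
  obtain ⟨K, hK, hmax⟩ := Finset.exists_max_image S Finsupp.degree hSne
  obtain ⟨l0, -, hl0⟩ := Finset.mem_biUnion.mp hK
  have hconst : ∀ l, hasse K (c l) = C ((c l).coeff K) := by
    intro l
    ext J
    rw [coeff_hasse, coeff_C]
    split_ifs with hJ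
    · rw [← hJ, zero_add]
      have : bin 0 K = 1 := by
        unfold bin
        have h0 : fct 0 = 1 := by simp [fct]
        rw [zero_add, h0, one_mul, div_self (fct_pos K).ne']
      rw [this, one_mul]
    · have : (c l).coeff (J + K) = 0 := by
        by_contra hc0
        have := hmax (J + K) (Finset.mem_biUnion.mpr ⟨l, Finset.mem_univ _, mem_support_iff.mpr hc0⟩)
        rw [map_add] at this
        have h0 : J.degree = 0 := by omega
        rw [Finsupp.degree_eq_zero_iff] at h0
        exact hJ h0.symm
      rw [this, mul_zero]
  have h1 := Ann_succ φ s h _ (Ann_hasse φ s h c hc K) 0 (by simp)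
  simp only [hasse_zero, hconst] at h1
  rw [Fintype.linearIndependent_iff] at hφ
  have h2 := hφ (fun l => (c l).coeff K) (by
    rw [← h1]
    apply Finset.sum_congr rfl
    intro l _
    rw [MvPolynomial.smul_eq_C_mul]) l0
  exact mem_support_iff.mp hl0 h2

lemma Vs_top {k : ℕ} (φ : Fin k → MP) (hφ : LinearIndependent ℝ φ) (s : ℕ)
    (h : Vs φ (s + 1) ≤ Vs φ s) : Vs φ s = ⊤ := by
  classical
  by_contra hne
  obtain ⟨f, hf0, hf⟩ := Submodule.exists_le_ker_of_lt_top _ (lt_top_iff_ne_top.mpr hne)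
  obtain ⟨b, hb⟩ := IsLocalization.exist_integer_multiples_of_finite (nonZeroDivisors MP)
    (fun l : Fin k => f (Pi.single l 1))
  choose c hc using hb
  have hbne : algebraMap MP FF (b : MP) ≠ 0 := by
    intro h0
    have := (map_eq_zero_iff _ (IsFractionRing.injective MP FF)).mp h0
    exact nonZeroDivisors.ne_zero b.2 this
  have hfv : ∀ v : Fin k → FF, f v = ∑ l, v l * f (Pi.single l 1) := by
    intro v
    conv_lhs => rw [pi_eq_sum_univ' v]
    rw [map_sum]
    apply Finset.sum_congr rfl
    intro l _
    rw [map_smul, smul_eq_mul]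
  have hann : Ann φ s c := by
    intro I hI
    have h1 : f (hvec φ I) = 0 := hf (Submodule.subset_span ⟨I, hI, rfl⟩)
    apply IsFractionRing.injective MP FF
    rw [map_sum, map_zero]
    have h2 : ∑ l, algebraMap MP FF (c l * hasse I (φ l)) = algebraMap MP FF b * f (hvec φ I) := by
      rw [hfv, Finset.mul_sum]
      apply Finset.sum_congr rfl
      intro l _
      rw [map_mul, hc, Algebra.smul_def]
      unfold hvec
      ring
    rw [h2, h1, mul_zero]
  have hc0 := Ann_eq_zero φ hφ s h c hann
  apply hf0
  apply LinearMap.ext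
  intro v
  rw [hfv, LinearMap.zero_apply]
  apply Finset.sum_eq_zero
  intro l _
  have h3 := hc l
  rw [hc0, Pi.zero_apply, map_zero, Algebra.smul_def] at h3
  have : f (Pi.single l 1) = 0 := by
    rcases mul_eq_zero.mp h3.symm with h4 | h4
    · exact absurd h4 hbne
    · exact h4
  rw [this, mul_zero]

lemma Vs_rank {k : ℕ} (φ : Fin k → MP) (hφ : LinearIndependent ℝ φ) (s : ℕ) :
    min s k ≤ Module.finrank FF (Vs φ s) := by
  induction s with
  | zero => simp
  | succ s ih =>
    by_cases h : Vs φ (s + 1) ≤ Vs φ s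
    · have h1 := Vs_top φ hφ s h
      have h2 : Vs φ (s + 1) = ⊤ := by
        rw [eq_top_iff, ← h1]; exact Vs_mono φ s
      rw [h2, finrank_top, Module.finrank_fin_fun]
      exact min_le_right _ _
    · have := Submodule.finrank_lt_finrank_of_lt (lt_of_le_not_ge (Vs_mono φ s) h)
      omega

theorem wronskian {k : ℕ} (φ : Fin k → MP) (hφ : LinearIndependent ℝ φ) :
    ∃ I : Fin k → (ℕ →₀ ℕ), (∀ i, (I i).degree < k) ∧
      (Matrix.of fun i l => hasse (I i) (φ l)).det ≠ 0 := by
  classical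
  have htop : Vs φ k = ⊤ := by
    apply Submodule.eq_top_of_finrank_eq
    rw [Module.finrank_fin_fun]
    apply le_antisymm
    · have := Submodule.finrank_le (Vs φ k)
      rwa [Module.finrank_fin_fun] at this
    · have := Vs_rank φ hφ k
      rwa [min_self] at this
  obtain ⟨b, hb, hspan, hli⟩ := exists_linearIndependent FF
    {v | ∃ I : ℕ →₀ ℕ, I.degree < k ∧ v = hvec φ I}
  have hspan' : Submodule.span FF b = ⊤ := by rw [hspan]; exact htop
  have bas := Module.Basis.mk hli (by rw [Subtype.range_coe, hspan'])
  haveI : Finite b := Module.Finite.finite_basis bas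
  haveI := Fintype.ofFinite b
  have hcard : Fintype.card b = k := by
    rw [← Module.finrank_eq_card_basis bas, Module.finrank_fin_fun]
  let e : Fin k ≃ b := (Fintype.equivFinOfCardEq hcard).symm
  have hI : ∀ i : Fin k, ∃ I : ℕ →₀ ℕ, I.degree < k ∧ (e i : Fin k → FF) = hvec φ I :=
    fun i => hb (e i).2
  choose I hI1 hI2 using hI
  refine ⟨I, hI1, ?_⟩
  have hli2 : LinearIndependent FF (fun i => (e i : Fin k → FF)) := hli.comp e e.injective
  intro hdet
  have h1 : (Matrix.of fun i l => algebraMap MP FF (hasse (I i) (φ l))).det = 0 := by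
    have := congrArg (algebraMap MP FF) hdet
    rw [RingHom.map_det, map_zero] at this
    exact this
  have h2 : LinearIndependent FF (Matrix.of fun i l => algebraMap MP FF (hasse (I i) (φ l))).row := by
    convert hli2 using 1
    ext i l
    rw [hI2]; rfl
  rw [Matrix.linearIndependent_rows_iff_isUnit, Matrix.isUnit_iff_isUnit_det, h1] at h2
  exact not_isUnit_zero h2

end RothThm


namespace RothThm
open MvPolynomial

/-- embedding of univariate polynomials in the `n`-th variable -/
noncomputable def emb (n : ℕ) : Polynomial ℝ →ₐ[ℝ] MP := Polynomial.aeval (X n)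

lemma emb_eq (n : ℕ) (F : Polynomial ℝ) :
    emb n F = ∑ a ∈ F.support, monomial (Finsupp.single n a) (F.coeff a) := by
  unfold emb
  rw [Polynomial.aeval_eq_sum_range, Finset.sum_subset Polynomial.supp_subset_range_natDegree_succ]
  · apply Finset.sum_congr rfl
    intro a _
    rw [X_pow_eq_monomial, smul_monomial, smul_eq_mul, mul_one]
  · intro a _ ha
    rw [Polynomial.notMem_support_iff.mp ha]; simp

lemma coeff_emb (n : ℕ) (F : Polynomial ℝ) (a : ℕ) :
    (emb n F).coeff (Finsupp.single n a) = F.coeff a := by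
  classical
  rw [emb_eq, coeff_sum, Finset.sum_eq_single a]
  · simp
  · intro b _ hb
    rw [coeff_monomial, if_neg]
    intro h
    exact hb (Finsupp.single_injective n h)
  · intro h
    rw [Polynomial.notMem_support_iff.mp h]; simp

lemma T_emb (n : ℕ) (β : ℕ → ℝ) (F : Polynomial ℝ) :
    T β (emb n F) = emb n (Polynomial.taylor (β n) F) := by
  have h : (T β).comp (emb n) = (emb n).comp (Polynomial.taylorAlgHom (β n)) := by
    apply Polynomial.algHom_ext
    simp [emb, T_X, MvPolynomial.algebraMap_eq]
  exact DFunLike.congr_fun h F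

lemma prim_pow {f : Polynomial ℤ} (hf : f.IsPrimitive) (l : ℕ) : (f ^ l).IsPrimitive := by
  induction l with
  | zero => simpa using Polynomial.isPrimitive_one
  | succ l ih => rw [pow_succ]; exact ih.mul hf

lemma one_var {n : ℕ} {r : ℕ → ℕ} (hr : ∀ j, j ≠ n → r j = 0) {V : MP} (hV : DegLe r V)
    (hisint : IsInt V) (hne : V ≠ 0) (p : ℤ) (q : ℕ) (hq : 0 < q) (hpq : IsCoprime p (q : ℤ))
    (β : ℕ → ℝ) (hβ : β n = p / q) :
    ∃ a, (T β V).coeff (Finsupp.single n a) ≠ 0 ∧ (q : ℝ) ^ a ≤ wN (fun _ => 1) V := by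
  classical
  choose z hz using hisint
  set f : Polynomial ℤ := ∑ a ∈ Finset.range (r n + 1), Polynomial.monomial a (z (Finsupp.single n a))
    with hf
  have hfc : ∀ a, ((f.coeff a : ℤ) : ℝ) = V.coeff (Finsupp.single n a) := by
    intro a
    rw [hf, Polynomial.finsetSum_coeff]
    simp only [Polynomial.coeff_monomial]
    rw [Finset.sum_ite_eq']
    split_ifs with h
    · exact (hz _).symm
    · by_contra hc
      have := hV (Finsupp.single n a) (by intro h0; apply hc; rw [h0]; simp) n
      simp at this h
      omega
  have hVf : V = emb n (f.map (Int.castRingHom ℝ)) := by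
    ext I
    by_cases hI : I = Finsupp.single n (I n)
    · rw [hI, coeff_emb, ← hfc]; simp
    · have h1 : V.coeff I = 0 := by
        by_contra hc
        apply hI
        ext j
        by_cases hj : j = n
        · subst hj; simp
        · have := hV I hc j
          rw [hr j hj] at this
          simp [Finsupp.single_apply, Ne.symm hj]
          omega
      rw [h1, emb_eq, coeff_sum]
      symm
      apply Finset.sum_eq_zero
      intro a _
      rw [coeff_monomial, if_neg]
      rintro rfl
      apply hI; simp
  have hf0 : f ≠ 0 := by
    intro h; apply hne; rw [hVf, h]; simp
  set fq := f.map (Int.castRingHom ℚ) with hfq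
  have hfq0 : fq ≠ 0 := by
    rw [hfq, Ne, Polynomial.map_eq_zero_iff (RingHom.injective_int _)]
    exact hf0
  set b : ℚ := p / q with hb
  obtain ⟨g, hg, hgb⟩ := Polynomial.exists_eq_pow_rootMultiplicity_mul_and_not_dvd fq hfq0 b
  set l := Polynomial.rootMultiplicity b fq with hl
  have hq' : (q : ℚ) ≠ 0 := by positivity
  refine ⟨l, ?_, ?_⟩
  · rw [hVf, T_emb, coeff_emb]
    have e1 : Polynomial.taylor (β n) (f.map (Int.castRingHom ℝ)) =
        (Polynomial.taylor b fq).map (Rat.castHom ℝ) := by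
      have : β n = Rat.castHom ℝ b := by rw [hβ, hb]; simp
      rw [this, Polynomial.map_taylor, hfq, Polynomial.map_map]
      congr 2
    rw [e1, Polynomial.coeff_map, hg, Polynomial.taylor_mul, Polynomial.taylor_pow]
    have e2 : Polynomial.taylor b (Polynomial.X - Polynomial.C b) = Polynomial.X := by
      simp
    rw [e2]
    have := Polynomial.coeff_X_pow_mul (Polynomial.taylor b g) l 0
    rw [zero_add] at this
    rw [this, Polynomial.taylor_coeff_zero]
    rw [Polynomial.dvd_iff_isRoot, Polynomial.IsRoot] at hgb
    simpa using hgb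
  · have hprim : (Polynomial.C (q : ℤ) * Polynomial.X + Polynomial.C (-p)).IsPrimitive := by
      rw [Polynomial.isPrimitive_iff_isUnit_of_C_dvd]
      intro r hr
      rw [Polynomial.C_dvd_iff_dvd_coeff] at hr
      have h0 := hr 0
      have h1 := hr 1
      rw [Polynomial.coeff_add, Polynomial.coeff_C_mul, Polynomial.coeff_C,
        Polynomial.coeff_X] at h0 h1
      simp at h0 h1
      exact hpq.isUnit_of_dvd' h0 h1
    have hdvd : (Polynomial.C (q : ℤ) * Polynomial.X + Polynomial.C (-p)) ^ l ∣ f := by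
      rw [Polynomial.IsPrimitive.Int.dvd_iff_map_cast_dvd_map_cast _ _ (prim_pow hprim l)]
      rw [← hfq, hg]
      have : Polynomial.map (Int.castRingHom ℚ)
          ((Polynomial.C (q : ℤ) * Polynomial.X + Polynomial.C (-p)) ^ l) =
          (Polynomial.C (q : ℚ)) ^ l * (Polynomial.X - Polynomial.C b) ^ l := by
        rw [← mul_pow, Polynomial.map_pow]
        congr 1
        simp only [Polynomial.map_add, Polynomial.map_mul, Polynomial.map_C, Polynomial.map_X]
        rw [mul_sub, ← Polynomial.C_mul, hb, mul_div_cancel₀ _ hq']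
        simp [sub_eq_add_neg]
      rw [this]
      have hu : IsUnit ((Polynomial.C (q : ℚ)) ^ l) :=
        (Polynomial.isUnit_C.mpr (IsUnit.mk0 _ hq')).pow l
      rw [hu.mul_left_dvd]
      exact dvd_mul_right _ _
    obtain ⟨h, hh⟩ := hdvd
    have hlc : f.leadingCoeff = (q : ℤ) ^ l * h.leadingCoeff := by
      have e := congrArg Polynomial.leadingCoeff hh
      rw [Polynomial.leadingCoeff_mul, Polynomial.leadingCoeff_pow,
        Polynomial.leadingCoeff_linear (by positivity)] at e
      exact e
    have hh0 : h.leadingCoeff ≠ 0 := by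
      intro h0
      rw [h0, mul_zero] at hlc
      exact hf0 (Polynomial.leadingCoeff_eq_zero.mp hlc)
    have h1 : (1 : ℝ) ≤ |(h.leadingCoeff : ℝ)| := by
      exact_mod_cast Int.one_le_abs hh0
    have h2 : |((f.leadingCoeff : ℤ) : ℝ)| = (q : ℝ) ^ l * |(h.leadingCoeff : ℝ)| := by
      rw [hlc]; push_cast; rw [abs_mul, abs_pow, Nat.abs_cast]
    have h3 := coeff_le_wN (ρ := fun _ => 1) (fun _ => zero_le_one) V
      (Finsupp.single n f.natDegree)
    rw [← hfc, mon_one, mul_one] at h3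
    change |((f.leadingCoeff : ℤ) : ℝ)| ≤ _ at h3
    rw [h2] at h3
    refine le_trans ?_ h3
    have : (0 : ℝ) ≤ (q : ℝ) ^ l := by positivity
    nlinarith

/-- decomposition into a minimal sum of products in separate variables -/
lemma decomp {n : ℕ} {r : ℕ → ℕ} {P : MP} (hP : DegLe r P) (hne : P ≠ 0) :
    ∃ (k : ℕ) (φ ψ : Fin k → MP), 0 < k ∧ k ≤ r n + 1 ∧ LinearIndependent ℝ φ ∧
      LinearIndependent ℝ ψ ∧ P = ∑ l, φ l * ψ l ∧
      (∀ l, DegLe (Function.update r n 0) (φ l)) ∧ (∀ l, DegLe (Pi.single n (r n)) (ψ l)) := by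
  classical
  -- coefficients of powers of `X n`
  let c : ℕ → MP := fun a => ∑ I ∈ P.support.filter (fun I => I n = a),
    monomial (I.erase n) (P.coeff I)
  have hPc : P = ∑ a ∈ Finset.range (r n + 1), c a * X n ^ a := by
    have h1 : ∀ a, c a * X n ^ a = ∑ I ∈ P.support.filter (fun I => I n = a),
        monomial I (P.coeff I) := by
      intro a
      rw [Finset.sum_mul]
      apply Finset.sum_congr rfl
      intro I hI
      rw [X_pow_eq_monomial, monomial_mul, mul_one]
      congr 1
      rw [← (Finset.mem_filter.mp hI).2, Finsupp.erase_add_single]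
    simp_rw [h1]
    rw [Finset.sum_fiberwise_of_maps_to]
    · exact P.as_sum
    · intro I hI
      have := hP I (mem_support_iff.mp hI) n
      simp; omega
  have hcdeg : ∀ a, DegLe (Function.update r n 0) (c a) := by
    intro a
    apply DegLe.sum
    intro I hI K hK j
    rw [coeff_monomial] at hK
    split_ifs at hK with h
    · rw [← h]
      by_cases hj : j = n
      · subst hj; simp
      · rw [Finsupp.erase_ne hj, Function.update_of_ne hj]
        exact hP I hK j
    · simp at hK
  let S : Submodule ℝ MP := Submodule.span ℝ (Set.range (fun a : Fin (r n + 1) => c a))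
  haveI : Module.Finite ℝ S := Module.Finite.span_of_finite ℝ (Set.finite_range _)
  let bas := Module.finBasis ℝ S
  have hmem : ∀ a : Fin (r n + 1), c a ∈ S := fun a => Submodule.subset_span ⟨a, rfl⟩
  let φ : Fin (Module.finrank ℝ S) → MP := fun l => (bas l : MP)
  let ψ : Fin (Module.finrank ℝ S) → MP := fun l =>
    ∑ a : Fin (r n + 1), C (bas.repr ⟨c a, hmem a⟩ l) * X n ^ (a : ℕ)
  have hφ : LinearIndependent ℝ φ := bas.linearIndependent.map' S.subtype (Submodule.ker_subtype S)
  have hψc : ∀ l (a : Fin (r n + 1)), (ψ l).coeff (Finsupp.single n a) =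
      bas.repr ⟨c a, hmem a⟩ l := by
    intro l a
    simp only [ψ]
    rw [coeff_sum, Finset.sum_eq_single a]
    · rw [coeff_C_mul, coeff_X_pow]; simp
    · intro b _ hb
      rw [coeff_C_mul, coeff_X_pow, if_neg, mul_zero]
      intro h
      exact hb (Fin.ext (Finsupp.single_injective n h))
    · intro h; exact absurd (Finset.mem_univ _) h
  have hψ : LinearIndependent ℝ ψ := by
    rw [Fintype.linearIndependent_iff]
    intro g hg
    let L : S →ₗ[ℝ] ℝ := bas.constr ℝ g
    have hL : ∀ x : S, L x = ∑ l, bas.repr x l * g l := by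
      intro x
      simp [L, Module.Basis.constr_apply_fintype]
    have hL0 : ∀ x (hx : x ∈ S), L ⟨x, hx⟩ = 0 := by
      intro x hx
      induction hx using Submodule.span_induction with
      | mem x h =>
        obtain ⟨a, rfl⟩ := h
        have h1 := congrArg (MvPolynomial.coeff (Finsupp.single n (a : ℕ))) hg
        rw [coeff_sum] at h1
        simp only [coeff_smul, hψc, coeff_zero] at h1
        rw [hL, ← h1]
        apply Finset.sum_congr rfl
        intro l _
        rw [smul_eq_mul, mul_comm]
      | zero => exact map_zero L
      | add x y hx hy h1 h2 =>
        have := map_add L ⟨x, hx⟩ ⟨y, hy⟩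
        rw [h1, h2, add_zero] at this
        exact this
      | smul a x hx h1 =>
        have := map_smul L a ⟨x, hx⟩
        rw [h1, smul_zero] at this
        exact this
    intro l
    have h1 := hL0 (bas l) (bas l).2
    simpa [L] using h1
  have hsum : P = ∑ l, φ l * ψ l := by
    have h1 : ∀ a : Fin (r n + 1), c a = ∑ l, C (bas.repr ⟨c a, hmem a⟩ l) * φ l := by
      intro a
      have := congrArg Subtype.val (bas.sum_repr ⟨c a, hmem a⟩)
      refine this.symm.trans ?_
      rw [AddSubmonoidClass.coe_finsetSum]
      apply Finset.sum_congr rfl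
      intro l _
      rw [Submodule.coe_smul, MvPolynomial.smul_eq_C_mul]
    rw [hPc, Finset.sum_range]
    simp only [ψ, Finset.mul_sum]
    rw [Finset.sum_comm]
    apply Finset.sum_congr rfl
    intro a _
    conv_lhs => rw [h1 a]
    rw [Finset.sum_mul]
    apply Finset.sum_congr rfl
    intro l _
    ring
  refine ⟨Module.finrank ℝ S, φ, ψ, ?_, ?_, hφ, hψ, hsum, ?_, ?_⟩
  · by_contra h0
    apply hne
    rw [hsum]
    have : IsEmpty (Fin (Module.finrank ℝ S)) := by
      have : Module.finrank ℝ S = 0 := by omega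
      rw [this]; infer_instance
    simp
  · have := finrank_range_le_card (R := ℝ) (fun a : Fin (r n + 1) => c a)
    rw [Fintype.card_fin] at this
    exact this
  · intro l
    have : ∀ x ∈ S, DegLe (Function.update r n 0) x := by
      intro x hx
      induction hx using Submodule.span_induction with
      | mem x h => obtain ⟨a, rfl⟩ := h; exact hcdeg a
      | zero => exact DegLe.zero _
      | add x y _ _ h1 h2 => exact h1.add h2
      | smul a x _ h1 =>
        rw [MvPolynomial.smul_eq_C_mul]
        have := (DegLe.C 0 a).mul h1
        rwa [zero_add] at this
    exact this _ (bas l).2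
  · intro l
    apply DegLe.sum
    intro a _ I hI j
    rw [coeff_C_mul, coeff_X_pow] at hI
    have h2 := right_ne_zero_of_mul hI
    split_ifs at h2 with h
    · rw [← h]
      by_cases hj : j = n
      · subst hj; simp; omega
      · simp [Finsupp.single_apply, Ne.symm hj]
    · simp at h2

end RothThm


namespace RothThm
open MvPolynomial

lemma DegLe.det {k : ℕ} {r : ℕ → ℕ} (M : Matrix (Fin k) (Fin k) MP) (h : ∀ i j, DegLe r (M i j)) :
    DegLe (fun j => k * r j) M.det := by
  apply det_induction M (DegLe (fun j => k * r j))
  · exact DegLe.zero _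
  · intro a b ha hb; exact ha.add hb
  · intro a ha I hI
    exact ha I (by simpa using hI)
  · intro σ
    have := DegLe.prod Finset.univ (fun _ => r) (fun i => M (σ i) i) (fun i _ => h _ _)
    refine this.mono fun j => ?_
    simp

lemma IsInt.det {k : ℕ} (M : Matrix (Fin k) (Fin k) MP) (h : ∀ i j, IsInt (M i j)) :
    IsInt M.det := by
  apply det_induction M IsInt
  · exact IsInt.zero
  · intro a b ha hb; exact ha.add hb
  · intro a ha; exact ha.neg
  · intro σ
    exact Finset.prod_induction _ IsInt (fun a b ha hb => ha.mul hb) IsInt.one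
      (fun i _ => h _ _)

lemma eq_single_of {n : ℕ} (J : ℕ →₀ ℕ) (h : ∀ j, j ≠ n → J j = 0) :
    J = Finsupp.single n (J n) := by
  ext j
  by_cases hj : j = n
  · subst hj; simp
  · rw [h j hj, Finsupp.single_apply, if_neg (Ne.symm hj)]

lemma hasse_zero_right (I : ℕ →₀ ℕ) : hasse I 0 = 0 := by
  ext J; rw [coeff_hasse]; simp

lemma wr_split {n : ℕ} {r : ℕ → ℕ} {P : MP} (hP : DegLe r P) (hne : P ≠ 0)
    (hr : ∀ j, n + 1 ≤ j → r j = 0) :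
    ∃ (k : ℕ) (I : Fin k → (ℕ →₀ ℕ)) (U V : MP), 0 < k ∧ k ≤ r n + 1 ∧
      (∀ i, (I i).degree < k) ∧ (∀ i j, n ≤ j → I i j = 0) ∧ U ≠ 0 ∧ V ≠ 0 ∧
      DegLe (fun j => k * Function.update r n 0 j) U ∧
      DegLe (fun j => k * (Pi.single n (r n) : ℕ → ℕ) j) V ∧
      (Matrix.of fun i i' : Fin k =>
        hasse (I i) (hasse (Finsupp.single n (i' : ℕ)) P)).det = U * V := by
  classical
  obtain ⟨k, φ, ψ, hk, hkr, hφ, hψ, hPs, hφd, hψd⟩ := decomp (n := n) hP hne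
  obtain ⟨I, hIk, hU⟩ := wronskian φ hφ
  obtain ⟨J, hJk, hV⟩ := wronskian ψ hψ
  have hI0 : ∀ i j, n ≤ j → I i j = 0 := by
    intro i j hj
    by_contra hc
    apply hU
    apply Matrix.det_eq_zero_of_row_eq_zero i
    intro l
    apply hasse_eq_zero (hφd l) (I i) j
    have : Function.update r n 0 j = 0 := by
      by_cases h : j = n
      · subst h; simp
      · rw [Function.update_of_ne h]; exact hr j (by omega)
    omega
  have hJ0 : ∀ i j, j ≠ n → J i j = 0 := by
    intro i j hj
    by_contra hc
    apply hV
    apply Matrix.det_eq_zero_of_row_eq_zero i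
    intro l
    apply hasse_eq_zero (hψd l) (J i) j
    simp [hj]; omega
  have hJs : ∀ i, J i = Finsupp.single n (J i n) := fun i => eq_single_of _ (hJ0 i)
  have hJlt : ∀ i, J i n < k := by
    intro i
    have := hJk i
    rw [hJs i, Finsupp.degree_single] at this
    exact this
  let a : Fin k → Fin k := fun i => ⟨J i n, hJlt i⟩
  have hainj : Function.Injective a := by
    intro i i' h
    by_contra hc
    apply hV
    apply Matrix.det_zero_of_row_eq hc
    funext l
    have : J i = J i' := by
      rw [hJs i, hJs i', show J i n = J i' n from congrArg Fin.val h]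
    simp only [Matrix.of_apply, this]
  let σ : Equiv.Perm (Fin k) := Equiv.ofBijective a (Finite.injective_iff_bijective.mp hainj)
  set MV : Matrix (Fin k) (Fin k) MP := Matrix.of fun i l => hasse (Finsupp.single n (i : ℕ)) (ψ l)
    with hMV
  have hV' : MV.det ≠ 0 := by
    intro h0
    apply hV
    have : (Matrix.of fun i l => hasse (J i) (ψ l)) = MV.submatrix σ id := by
      ext1 i l
      simp only [hMV, Matrix.submatrix_apply, Matrix.of_apply, id]
      conv_lhs => rw [hJs i]
      rfl
    rw [this, Matrix.det_permute, h0, mul_zero]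
  refine ⟨k, I, _, MV.det, hk, hkr, hIk, hI0, hU, hV', ?_, ?_, ?_⟩
  · apply DegLe.det
    intro i l
    exact (hφd l).hasse _
  · apply DegLe.det
    intro i l
    exact (hψd l).hasse _
  · rw [← Matrix.det_transpose MV, ← Matrix.det_mul]
    congr 1
    ext1 i i'
    rw [Matrix.mul_apply]
    simp only [Matrix.of_apply, Matrix.transpose_apply, hMV]
    conv_lhs => rw [hPs]
    rw [hasse_sum, hasse_sum]
    apply Finset.sum_congr rfl
    intro l _
    rw [mul_comm (φ l), hasse_mul_of_left (ψ l) (hφd l), mul_comm, hasse_mul_of_left (φ l)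
      ((hψd l).hasse _)]
    · intro j hj
      have : j ≠ n := by rintro rfl; exact hj (hI0 i j le_rfl)
      simp [this]
    · intro j hj
      have : j = n := by
        by_contra h
        apply hj
        simp [Finsupp.single_apply, Ne.symm h]
      subst this; simp

lemma sum_max_le {k r : ℕ} (hk : 0 < k) (hkr : k ≤ r + 1) (hr : 0 < r) {δ : ℝ} (hδ : 0 < δ)
    (hδ1 : δ ≤ 1) :
    k * δ ^ 2 / 8 ≤ ∑ i : Fin k, max 0 (δ - (i : ℕ) / r) := by
  rw [Fin.sum_univ_eq_sum_range (fun i => max 0 (δ - (i : ℝ) / r)) k]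
  have hk1 : (1 : ℝ) ≤ k := by exact_mod_cast hk
  set N := ⌊δ * (k - 1) / 2⌋₊ + 1 with hN
  have h0 : 0 ≤ δ * (k - 1) / 2 := by
    have : (0 : ℝ) ≤ k - 1 := by linarith
    positivity
  have hNk : N ≤ k := by
    have : ⌊δ * (k - 1) / 2⌋₊ ≤ k - 1 := by
      apply Nat.floor_le_of_le
      rw [Nat.cast_sub hk, Nat.cast_one]
      nlinarith
    omega
  have h1 : δ * (k - 1) / 2 < N := by
    rw [hN]; push_cast; exact Nat.lt_floor_add_one _
  have h2 : (1 : ℝ) ≤ N := by rw [hN]; push_cast; linarith [(Nat.cast_nonneg ⌊δ * (k - 1) / 2⌋₊ : (0:ℝ) ≤ _)]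
  have hr' : (0 : ℝ) < r := by exact_mod_cast hr
  have hkr' : (k : ℝ) ≤ r + 1 := by exact_mod_cast hkr
  calc k * δ ^ 2 / 8 ≤ ∑ i ∈ Finset.range N, δ / 2 := by
        rw [Finset.sum_const, Finset.card_range, nsmul_eq_mul]
        nlinarith
    _ ≤ ∑ i ∈ Finset.range N, max 0 (δ - (i : ℝ) / r) := by
        apply Finset.sum_le_sum
        intro i hi
        have hi' : i ≤ ⌊δ * (k - 1) / 2⌋₊ := by have := Finset.mem_range.mp hi; omega
        have h3 : (i : ℝ) ≤ δ * (k - 1) / 2 :=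
          (Nat.cast_le.mpr hi').trans (Nat.floor_le h0)
        have h4 : (i : ℝ) / r ≤ δ / 2 := by
          rw [div_le_iff₀ hr']; nlinarith
        exact le_max_of_le_right (by linarith)
    _ ≤ _ := by
        apply Finset.sum_le_sum_of_subset_of_nonneg
        · intro i hi; simp at hi ⊢; omega
        · intro i _ _; exact le_max_left _ _

lemma wt_mono_right {w w' : ℕ → ℝ} (I : ℕ →₀ ℕ) (h : ∀ j, I j ≠ 0 → w j ≤ w' j) :
    wt w I ≤ wt w' I := by
  unfold wt
  apply Finset.sum_le_sum
  intro j hj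
  exact mul_le_mul_of_nonneg_right (h j (Finsupp.mem_support_iff.mp hj)) (Nat.cast_nonneg _)

lemma wt_const (c : ℝ) (I : ℕ →₀ ℕ) : wt (fun _ => c) I = c * I.degree := by
  unfold wt
  rw [Finsupp.sum, ← Finset.mul_sum, Finsupp.degree_apply]
  push_cast; rfl

/-- if `U * V` in separated variables is integral then scaling `U` by a coefficient of `V`
is integral with norm bounded -/
lemma scaled {r s : ℕ → ℕ} {U V : MP} (hU : DegLe r U) (hV : DegLe s V)
    (hd : ∀ j, r j = 0 ∨ s j = 0) (hisint : IsInt (U * V)) (hVne : V ≠ 0) :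
    ∃ v : ℝ, v ≠ 0 ∧ IsInt (C v * U) ∧
      wN (fun _ => 1) (C v * U) ≤ wN (fun _ => 1) (U * V) := by
  classical
  obtain ⟨J, hJ⟩ := MvPolynomial.ne_zero_iff.mp hVne
  refine ⟨V.coeff J, hJ, ?_, ?_⟩
  · intro I
    rw [coeff_C_mul]
    by_cases hI : U.coeff I = 0
    · exact ⟨0, by simp [hI]⟩
    · rw [mul_comm, ← coeff_mul_disjoint hU hV hd I J hI hJ]
      exact hisint _
  · have h1 : (C (V.coeff J) * U).support ⊆ U.support := by
      intro I hI
      rw [mem_support_iff, coeff_C_mul] at hI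
      exact mem_support_iff.mpr (right_ne_zero_of_mul hI)
    rw [wN_eq_of_subset _ _ _ h1]
    unfold wN
    have h2 : ∑ I ∈ U.support, |(C (V.coeff J) * U).coeff I| * mon (fun _ => 1) I =
        ∑ K ∈ U.support.map (addRightEmbedding J), |(U * V).coeff K| * mon (fun _ => 1) K := by
      rw [Finset.sum_map]
      apply Finset.sum_congr rfl
      intro I hI
      rw [addRightEmbedding_apply, coeff_mul_disjoint hU hV hd I J (mem_support_iff.mp hI) hJ,
        coeff_C_mul, mon_one, mon_one, mul_comm (V.coeff J)]
    rw [h2]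
    apply Finset.sum_le_sum_of_subset_of_nonneg
    · intro K hK
      obtain ⟨I, hI, rfl⟩ := Finset.mem_map.mp hK
      rw [mem_support_iff, addRightEmbedding_apply,
        coeff_mul_disjoint hU hV hd I J (mem_support_iff.mp hI) hJ]
      exact mul_ne_zero (mem_support_iff.mp hI) hJ
    · intro K _ _
      rw [mon_one]; positivity

theorem roth_lemma (n : ℕ) : ∀ ε : ℝ, 0 < ε → ε ≤ 1 → ∃ ω : ℝ, 0 < ω ∧ ω ≤ 1 ∧
    ∀ (r : ℕ → ℕ) (p : ℕ → ℤ) (q : ℕ → ℕ) (β : ℕ → ℝ) (L : ℝ) (P : MP),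
      (∀ j, j < n → 0 < r j) → (∀ j, n ≤ j → r j = 0) →
      (∀ i j, i < j → j < n → (r j : ℝ) ≤ ω * r i) →
      (∀ j, j < n → 0 < q j ∧ IsCoprime (p j) (q j : ℤ) ∧ β j = p j / q j) →
      0 ≤ L → (∀ j, j < n → L ≤ r j * Real.log (q j)) →
      (∑ j ∈ Finset.range n, (r j : ℝ)) * Real.log 8 ≤ ω * L →
      IsInt P → P ≠ 0 → DegLe r P → wN (fun _ => 1) P ≤ Real.exp (ω * L) →
      ∃ I, (T β P).coeff I ≠ 0 ∧ wt (fun j => 1 / (r j : ℝ)) I < ε := by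
  induction n with
  | zero =>
    intro ε hε _
    refine ⟨1, one_pos, le_rfl, ?_⟩
    intro r p q β L P _ hr _ _ _ _ _ _ hne hdeg _
    obtain ⟨I, hI⟩ := MvPolynomial.ne_zero_iff.mp (T_ne_zero β hne)
    refine ⟨I, hI, ?_⟩
    have : I = 0 := by
      ext j
      have := hdeg.T β I hI j
      rw [hr j (Nat.zero_le _)] at this
      simpa using this
    rw [this, wt_zero]; exact hε
  | succ n ih =>
    intro ε hε hε1
    obtain ⟨ω', hω', hω'1, IH⟩ := ih (ε ^ 2 / 64) (by positivity) (by nlinarith)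
    set ω := min (ω' / 2) (ε ^ 2 / 128) with hω
    have hωpos : 0 < ω := lt_min (by positivity) (by positivity)
    have hω2 : 2 * ω ≤ ω' := by
      have := min_le_left (ω' / 2) (ε ^ 2 / 128); linarith
    have hωε : ω ≤ ε ^ 2 / 128 := min_le_right _ _
    refine ⟨ω, hωpos, by linarith, ?_⟩
    intro r p q β L P hrpos hr0 hratio hpq hL hLq hS hisint hne hdeg hwN
    by_contra hcon
    push Not at hcon
    set w : ℕ → ℝ := fun j => 1 / (r j : ℝ) with hw
    have hw0 : ∀ j, 0 ≤ w j := fun j => by rw [hw]; positivity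
    have hord : Ord w ε (T β P) := hcon
    obtain ⟨k, I, U, V, hk, hkr, hIk, hI0, hU, hV, hUd, hVd, hW⟩ := wr_split hdeg hne hr0
    set M : Matrix (Fin k) (Fin k) MP := Matrix.of fun i i' : Fin k =>
        hasse (I i) (hasse (Finsupp.single n (i' : ℕ)) P) with hM
    have hrn : 0 < r n := hrpos n (Nat.lt_succ_self n)
    have hrn' : (0 : ℝ) < r n := by exact_mod_cast hrn
    have hk' : (0 : ℝ) < k := by exact_mod_cast hk
    -- lower bound for the order
    have hordM : ∀ i i' : Fin k, Ord w (max 0 (ε - ω - (i' : ℕ) / r n)) (T β (M i i')) := by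
      intro i i'
      have h1 := (hord.hasse (Finsupp.single n (i' : ℕ))).hasse (I i)
      rw [← T_hasse, ← T_hasse] at h1
      have h2 : wt w (I i) ≤ ω := by
        have h3 : wt w (I i) ≤ wt (fun _ => ω / r n) (I i) := by
          apply wt_mono_right
          intro j hj
          have hjn : j < n := by
            by_contra h; exact hj (hI0 i j (by omega))
          have h4 := hratio j n hjn (Nat.lt_succ_self n)
          have h5 : (0 : ℝ) < r j := by exact_mod_cast hrpos j (by omega)
          rw [hw]
          simp only
          rw [div_le_div_iff₀ h5 hrn']; linarith
        refine h3.trans ?_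
        rw [wt_const]
        have : ((I i).degree : ℝ) ≤ r n := by
          have := hIk i
          exact_mod_cast (by omega : (I i).degree ≤ r n)
        rw [div_mul_eq_mul_div, div_le_iff₀ hrn']
        exact mul_le_mul_of_nonneg_left this hωpos.le
      rw [wt_single] at h1
      intro K hK
      apply max_le
      · exact wt_nonneg hw0 K
      · refine le_trans ?_ (h1 K hK)
        have : w n * ((i' : ℕ) : ℝ) = (i' : ℕ) / r n := by rw [hw]; simp only; ring
        rw [this]; linarith
    have hε2 : ε ^ 2 ≤ ε := by nlinarith
    have hδ : ε / 2 ≤ ε - ω := by nlinarith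
    have hordW : Ord w (k * (ε - ω) ^ 2 / 8) (T β (U * V)) := by
      rw [← hW, AlgHom.map_det]
      apply det_induction _ (Ord w (k * (ε - ω) ^ 2 / 8))
      · exact Ord.zero _ _
      · intro a b ha hb; exact ha.add hb
      · intro a ha; exact ha.neg
      · intro σ
        have h1 := Ord.prod hw0 Finset.univ (fun i' : Fin k => max 0 (ε - ω - (i' : ℕ) / r n))
          (fun i' => T β (M (σ i') i')) (fun i' _ => hordM _ _)
        have h2 := sum_max_le hk hkr hrn (δ := ε - ω) (by linarith) (by linarith)
        intro K hK
        exact h2.trans (h1 K hK)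
    -- W
    have hWint : IsInt (U * V) := by
      rw [← hW]; exact IsInt.det _ fun i i' => (hisint.hasse _).hasse _
    set S := ∑ j ∈ Finset.range (n + 1), r j with hSdef
    have hScast : (∑ j ∈ Finset.range (n + 1), (r j : ℝ)) = (S : ℝ) := by
      rw [hSdef]; push_cast; rfl
    rw [hScast] at hS
    have h1S : 1 ≤ S := by
      have : r n ≤ S := Finset.single_le_sum (f := r) (fun _ _ => Nat.zero_le _) (by simp)
      omega
    have hrS : r n ≤ S := Finset.single_le_sum (f := r) (fun _ _ => Nat.zero_le _) (by simp)
    have hwN0 : 0 ≤ wN (fun _ => 1) P := wN_nonneg (fun _ => zero_le_one) _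
    have hhasse : ∀ (K : ℕ →₀ ℕ) (R : MP), DegLe r R →
        wN (fun _ => 1) (hasse K R) ≤ 2 ^ S * wN (fun _ => 1) R := fun K R hR =>
      (wN_hasse_le K R).trans (wN_le_pow_mul hr0 one_le_two hR)
    have hMle : ∀ i i', wN (fun _ => 1) (M i i') ≤ 4 ^ S * wN (fun _ => 1) P := by
      intro i i'
      have h1 := hhasse (I i) _ (hdeg.hasse (Finsupp.single n (i' : ℕ)))
      have h2 := hhasse (Finsupp.single n (i' : ℕ)) P hdeg
      calc _ ≤ _ := h1
        _ ≤ 2 ^ S * (2 ^ S * wN (fun _ => 1) P) := by gcongr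
        _ = _ := by rw [← mul_assoc, ← mul_pow]; norm_num
    have hWle : wN (fun _ => 1) (U * V) ≤ Real.exp (2 * ω * (k * L)) := by
      rw [← hW]
      refine (wN_det_le M _ hMle).trans ?_
      have h1 : (k.factorial : ℝ) ≤ (2 ^ S) ^ k := by
        have h2 : k.factorial ≤ k ^ k := Nat.factorial_le_pow k
        have h3 : k ≤ 2 ^ S := by
          have : r n < 2 ^ r n := Nat.lt_two_pow_self
          have : 2 ^ r n ≤ 2 ^ S := Nat.pow_le_pow_right (by norm_num) hrS
          omega
        exact_mod_cast h2.trans (Nat.pow_le_pow_left h3 k)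
      have h8 : (8 : ℝ) ^ S ≤ Real.exp (ω * L) := by
        rw [← Real.exp_log (show (0:ℝ) < 8 by norm_num), ← Real.exp_nat_mul]
        exact Real.exp_le_exp.mpr hS
      calc (k.factorial : ℝ) * (4 ^ S * wN (fun _ => 1) P) ^ k
          ≤ (2 ^ S) ^ k * (4 ^ S * Real.exp (ω * L)) ^ k := by gcongr
        _ = (8 ^ S * Real.exp (ω * L)) ^ k := by
            rw [← mul_pow, ← mul_assoc, ← mul_pow]; norm_num
        _ ≤ (Real.exp (ω * L) * Real.exp (ω * L)) ^ k := by gcongr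
        _ = _ := by
            rw [← Real.exp_add, ← Real.exp_nat_mul]; congr 1; ring
    have hdis : ∀ j, k * Function.update r n 0 j = 0 ∨ k * (Pi.single n (r n) : ℕ → ℕ) j = 0 := by
      intro j
      by_cases hj : j = n
      · subst hj; left; simp
      · right; simp [hj]
    obtain ⟨v, hv, hv1, hv2⟩ := scaled hUd hVd hdis hWint hV
    obtain ⟨u, hu, hu1, hu2⟩ := scaled hVd hUd (fun j => (hdis j).symm) (by rwa [mul_comm]) hU
    rw [mul_comm V U] at hu2
    have hCdeg : ∀ (c : ℝ) (s : ℕ → ℕ) (R : MP), DegLe s R → DegLe s (C c * R) := by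
      intro c s R hR
      have := (DegLe.C 0 c).mul hR
      rwa [zero_add] at this
    have hlog8 : 0 < Real.log 8 := Real.log_pos (by norm_num)
    have hLpos : 0 < L := by
      have : (1 : ℝ) ≤ S := by exact_mod_cast h1S
      have : 0 < ω * L := by
        refine lt_of_lt_of_le ?_ hS
        positivity
      exact pos_of_mul_pos_right this hωpos.le
    -- last variable
    obtain ⟨hqn, hcop, hβn⟩ := hpq n (Nat.lt_succ_self n)
    obtain ⟨a, ha1, ha2⟩ := one_var (n := n) (r := fun j => k * (Pi.single n (r n) : ℕ → ℕ) j)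
      (fun j hj => by simp [hj]) (hCdeg u _ V hVd) hu1
      (mul_ne_zero (by simpa using hu) hV) (p n) (q n) hqn hcop β hβn
    rw [map_mul, T_C, coeff_C_mul] at ha1
    have ha1 := right_ne_zero_of_mul ha1
    have hq0 : (0 : ℝ) < q n := by exact_mod_cast hqn
    have hlogq : 0 < Real.log (q n) := by
      have := hLq n (Nat.lt_succ_self n)
      exact pos_of_mul_pos_right (lt_of_lt_of_le hLpos this) hrn'.le
    have hale : w n * a ≤ 2 * ω * k := by
      have h1 : (a : ℝ) * Real.log (q n) ≤ 2 * ω * (k * L) := by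
        rw [← Real.exp_le_exp, Real.exp_nat_mul, Real.exp_log hq0]
        exact ha2.trans (hu2.trans hWle)
      have h2 : 2 * ω * (k * L) ≤ 2 * ω * k * r n * Real.log (q n) := by
        have := mul_le_mul_of_nonneg_left (hLq n (Nat.lt_succ_self n))
          (show 0 ≤ 2 * ω * k by positivity)
        linarith
      have h3 : (a : ℝ) ≤ 2 * ω * k * r n := le_of_mul_le_mul_right (h1.trans h2) hlogq
      rw [hw]; simp only
      rw [one_div, inv_mul_le_iff₀ hrn']; linarith
    -- the other variables
    obtain ⟨K, hK1, hK2⟩ := IH (fun j => k * Function.update r n 0 j) p q β (k * L) (C v * U)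
      (fun j hj => by
        rw [Function.update_of_ne (by omega)]
        exact Nat.mul_pos hk (hrpos j (by omega)))
      (fun j hj => by
        by_cases h : j = n
        · subst h; simp
        · rw [Function.update_of_ne h, hr0 j (by omega), mul_zero])
      (fun i j hij hj => by
        rw [Function.update_of_ne (by omega), Function.update_of_ne (by omega)]
        push_cast
        have h1 := hratio i j hij (by omega)
        have h2 : ω * r i ≤ ω' * r i := by
          apply mul_le_mul_of_nonneg_right _ (Nat.cast_nonneg _); linarith
        have := mul_le_mul_of_nonneg_left (h1.trans h2) hk'.le
        linarith)
      (fun j hj => hpq j (by omega))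
      (by positivity)
      (fun j hj => by
        rw [Function.update_of_ne (by omega)]
        push_cast
        have := mul_le_mul_of_nonneg_left (hLq j (by omega)) hk'.le
        linarith)
      (by
        have h1 : ∑ j ∈ Finset.range n, ((k * Function.update r n 0 j : ℕ) : ℝ) ≤ k * S := by
          have : ∑ j ∈ Finset.range n, (k * Function.update r n 0 j) ≤ k * S := by
            rw [← Finset.mul_sum]
            apply Nat.mul_le_mul_left
            rw [hSdef, Finset.sum_range_succ]
            refine le_trans (Finset.sum_le_sum fun j hj => ?_) (Nat.le_add_right _ _)
            rw [Function.update_of_ne (by have := Finset.mem_range.mp hj; omega)]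
          exact_mod_cast this
        calc _ ≤ (k * S) * Real.log 8 := by gcongr
          _ ≤ k * (ω * L) := by nlinarith
          _ ≤ ω' * (k * L) := by
            have : 0 ≤ k * L := by positivity
            nlinarith)
      hv1 (mul_ne_zero (by simpa using hv) hU) (hCdeg v _ U hUd)
      (hv2.trans (hWle.trans (Real.exp_le_exp.mpr (by
        have : 0 ≤ k * L := by positivity
        nlinarith))))
    rw [map_mul, T_C, coeff_C_mul] at hK1
    have hK1 := right_ne_zero_of_mul hK1
    have hKw : wt w K = k * wt (fun j => 1 / ((k * Function.update r n 0 j : ℕ) : ℝ)) K := by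
      have hKn : ∀ j, n ≤ j → K j = 0 := by
        intro j hj
        have := hUd.T β K hK1 j
        by_cases h : j = n
        · subst h; simpa using this
        · rw [Function.update_of_ne h, hr0 j (by omega)] at this; omega
      rw [wt_eq_sum_range _ _ n hKn, wt_eq_sum_range _ _ n hKn, Finset.mul_sum]
      apply Finset.sum_congr rfl
      intro j hj
      have hj := Finset.mem_range.mp hj
      have : (0 : ℝ) < r j := by exact_mod_cast hrpos j (by omega)
      rw [Function.update_of_ne (by omega), hw]
      push_cast
      field_simp
    have hfin := hordW (K + Finsupp.single n a) (by
      rw [map_mul, coeff_mul_disjoint (hUd.T β) (hVd.T β) hdis _ _ hK1 ha1]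
      exact mul_ne_zero hK1 ha1)
    rw [wt_add, wt_single, hKw] at hfin
    have h1 : k * wt (fun j => 1 / ((k * Function.update r n 0 j : ℕ) : ℝ)) K < k * (ε ^ 2 / 64) :=
      mul_lt_mul_of_pos_left hK2 hk'
    have h2 : (ε / 2) ^ 2 ≤ (ε - ω) ^ 2 := by
      apply pow_le_pow_left₀ (by positivity) hδ
    have h3 : k * (ε / 2) ^ 2 ≤ k * (ε - ω) ^ 2 := mul_le_mul_of_nonneg_left h2 hk'.le
    have h4 : 2 * ω * k ≤ 2 * (ε ^ 2 / 128) * k := by gcongr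
    have h5 : k * (ε / 2) ^ 2 = 16 * (k * (ε ^ 2 / 64)) := by ring
    have h6 : 2 * (ε ^ 2 / 128) * k = k * (ε ^ 2 / 64) := by ring
    linarith

end RothThm


namespace RothThm
open MvPolynomial

/-- reduction of powers of an algebraic number -/
lemma red (α : ℝ) (g : Polynomial ℤ) (e : ℕ) (hg : g.natDegree = e + 1)
    (hα : Polynomial.aeval α g = 0) :
    ∃ (A : ℝ) (c : ℕ → ℕ → ℤ), 1 ≤ A ∧ |(g.leadingCoeff : ℝ)| ≤ A ∧
      (∀ s, (g.leadingCoeff : ℝ) ^ s * α ^ s = ∑ f ∈ Finset.range (e + 1), c s f * α ^ f) ∧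
      ∀ s f, |(c s f : ℝ)| ≤ (2 * A) ^ s := by
  classical
  set a := g.leadingCoeff with ha
  set A : ℝ := 1 + ∑ f ∈ Finset.range (e + 2), |(g.coeff f : ℝ)| with hA
  have hA1 : 1 ≤ A := by
    have : 0 ≤ ∑ f ∈ Finset.range (e + 2), |(g.coeff f : ℝ)| :=
      Finset.sum_nonneg fun _ _ => abs_nonneg _
    linarith
  have hAf : ∀ f, |(g.coeff f : ℝ)| ≤ A := by
    intro f
    by_cases hf : f < e + 2
    · have := Finset.single_le_sum (f := fun f => |(g.coeff f : ℝ)|) (fun _ _ => abs_nonneg _)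
        (Finset.mem_range.mpr hf)
      linarith
    · rw [Polynomial.coeff_eq_zero_of_natDegree_lt (by omega)]
      simp; linarith
  have haA : |(a : ℝ)| ≤ A := hAf _
  have hrel : (a : ℝ) * α ^ (e + 1) = - ∑ f ∈ Finset.range (e + 1), (g.coeff f : ℝ) * α ^ f := by
    rw [Polynomial.aeval_eq_sum_range, hg, Finset.sum_range_succ] at hα
    simp only [zsmul_eq_mul] at hα
    have : g.coeff (e + 1) = a := by rw [ha, Polynomial.leadingCoeff, hg]
    rw [this] at hα
    linarith
  have key : ∀ s : ℕ, ∃ c : ℕ → ℤ, ((a : ℝ) ^ s * α ^ s = ∑ f ∈ Finset.range (e + 1), c f * α ^ f) ∧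
      ∀ f, |(c f : ℝ)| ≤ (2 * A) ^ s := by
    intro s
    induction s with
    | zero =>
      refine ⟨fun f => if f = 0 then 1 else 0, ?_, ?_⟩
      · rw [Finset.sum_eq_single 0]
        · simp
        · intro b _ hb; simp [hb]
        · simp
      · intro f
        by_cases hf : f = 0 <;> simp [hf]
    | succ s ih =>
      obtain ⟨c, hc, hcb⟩ := ih
      refine ⟨fun f => (if f = 0 then 0 else a * c (f - 1)) - c e * g.coeff f, ?_, ?_⟩
      · have h1 : (a : ℝ) ^ (s + 1) * α ^ (s + 1) = a * α * ((a : ℝ) ^ s * α ^ s) := by ring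
        rw [h1, hc, Finset.sum_range_succ, mul_add]
        have h2 : (a : ℝ) * α * (c e * α ^ e) = c e * (a * α ^ (e + 1)) := by ring
        rw [h2, hrel]
        push_cast
        simp only [sub_mul, Finset.sum_sub_distrib]
        rw [Finset.sum_range_succ' (fun f => (if f = 0 then (0 : ℝ) else (a : ℝ) * c (f - 1)) * α ^ f)]
        simp only [Nat.add_sub_cancel, Nat.succ_ne_zero, if_false, if_true, zero_mul, add_zero]
        rw [Finset.mul_sum, mul_neg, Finset.mul_sum, sub_eq_add_neg]
        congr 1
        · apply Finset.sum_congr rfl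
          intro f _; ring
        · congr 1
          apply Finset.sum_congr rfl
          intro f _; ring
      · intro f
        push_cast
        have hp : 0 ≤ (2 * A) ^ s := by positivity
        have h1 : |((c e : ℝ)) * g.coeff f| ≤ (2 * A) ^ s * A := by
          rw [abs_mul]; exact mul_le_mul (hcb e) (hAf f) (abs_nonneg _) hp
        have h2 : |(if f = 0 then (0 : ℝ) else (a : ℝ) * c (f - 1))| ≤ (2 * A) ^ s * A := by
          split_ifs
          · rw [abs_zero]; positivity
          · rw [abs_mul, mul_comm]; exact mul_le_mul (hcb _) haA (abs_nonneg _) hp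
        calc _ ≤ _ := abs_sub _ _
          _ ≤ (2 * A) ^ s * A + (2 * A) ^ s * A := add_le_add h2 h1
          _ = _ := by ring
  choose c hc hcb using key
  exact ⟨A, c, hA1, haA, hc, hcb⟩

lemma mon_const (c : ℝ) (I : ℕ →₀ ℕ) : mon (fun _ => c) I = c ^ I.degree := by
  unfold mon
  rw [Finsupp.prod, Finset.prod_pow_eq_pow_sum, Finsupp.degree_apply]

lemma degree_eq_sum_range (I : ℕ →₀ ℕ) (n : ℕ) (h : ∀ j, n ≤ j → I j = 0) :
    I.degree = ∑ j ∈ Finset.range n, I j := by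
  rw [Finsupp.degree_apply]
  apply Finset.sum_subset
  · intro j hj
    rw [Finset.mem_range]
    by_contra hc
    exact (Finsupp.mem_support_iff.mp hj) (h j (by omega))
  · intro j _ hj
    exact Finsupp.notMem_support_iff.mp hj

lemma coeff_T_monomial (α : ℝ) (I J : ℕ →₀ ℕ) :
    (T (fun _ => α) (monomial J 1)).coeff I =
      if I ≤ J then bin (J - I) I * α ^ (J - I).degree else 0 := by
  classical
  rw [coeff_T]
  have hc : ∀ K, (hasse I (monomial J 1)).coeff K = bin K I * if J = K + I then 1 else 0 := by
    intro K; rw [coeff_hasse, coeff_monomial]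
  split_ifs with h
  · rw [Finset.sum_eq_single (J - I)]
    · rw [hc, if_pos (tsub_add_cancel_of_le h).symm, mon_const, mul_one]
    · intro K hK hne
      rw [hc, if_neg, mul_zero, zero_mul]
      intro h'
      apply hne
      rw [h', add_tsub_cancel_right]
    · intro hK
      rw [notMem_support_iff.mp hK, zero_mul]
  · apply Finset.sum_eq_zero
    intro K _
    rw [hc, if_neg, mul_zero, zero_mul]
    rintro rfl
    exact h le_add_self

/-- multi-indices as functions on `Fin m` -/
noncomputable def toF {m : ℕ} (x : Fin m → ℕ) : ℕ →₀ ℕ :=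
  Finsupp.onFinset (Finset.range m) (fun j => if h : j < m then x ⟨j, h⟩ else 0) (by
    intro j hj
    by_contra hc
    apply hj
    rw [dif_neg]
    simpa using hc)

lemma toF_lt {m : ℕ} (x : Fin m → ℕ) (i : Fin m) : toF x i = x i := by
  simp [toF]

lemma toF_ge {m : ℕ} (x : Fin m → ℕ) (j : ℕ) (h : m ≤ j) : toF x j = 0 := by
  simp [toF, Nat.not_lt.mpr h]

lemma toF_inj {m : ℕ} : Function.Injective (toF (m := m)) := by
  intro x y h
  funext i
  rw [← toF_lt x i, h, toF_lt]

noncomputable def box (m : ℕ) (r : ℕ → ℕ) : Finset (ℕ →₀ ℕ) :=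
  (Fintype.piFinset (fun i : Fin m => Finset.range (r i + 1))).map ⟨toF, toF_inj⟩

lemma mem_box {m : ℕ} {r : ℕ → ℕ} (hr : ∀ j, m ≤ j → r j = 0) (I : ℕ →₀ ℕ) :
    I ∈ box m r ↔ ∀ j, I j ≤ r j := by
  unfold box
  rw [Finset.mem_map]
  constructor
  · rintro ⟨x, hx, rfl⟩ j
    change toF x j ≤ _
    by_cases h : j < m
    · have := Fintype.mem_piFinset.mp hx ⟨j, h⟩
      rw [Finset.mem_range] at this
      have h2 := toF_lt x ⟨j, h⟩
      simp only at h2 this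
      omega
    · rw [toF_ge x j (by omega)]; exact Nat.zero_le _
  · intro h
    refine ⟨fun i => I i, ?_, ?_⟩
    · rw [Fintype.mem_piFinset]
      intro i; rw [Finset.mem_range]; have := h i; omega
    · ext j
      change toF (fun i : Fin m => I i) j = I j
      by_cases hj : j < m
      · exact toF_lt _ ⟨j, hj⟩
      · rw [toF_ge _ j (by omega)]
        have := h j; rw [hr j (by omega)] at this; omega

lemma card_box (m : ℕ) (r : ℕ → ℕ) : (box m r).card = ∏ j ∈ Finset.range m, (r j + 1) := by
  unfold box
  rw [Finset.card_map, Fintype.card_piFinset, Finset.prod_range]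
  simp

lemma exp_sum_le (r : ℕ) (hr : 0 < r) (l : ℝ) :
    ∑ i ∈ Finset.range (r + 1), Real.exp (-l * ((i : ℝ) / r - 1 / 2)) ≤
      (r + 1) * Real.exp (l ^ 2 / 8) := by
  have hr' : (0 : ℝ) < r := by exact_mod_cast hr
  have h1 : ∑ i ∈ Finset.range (r + 1), Real.exp (-l * ((i : ℝ) / r - 1 / 2)) =
      ∑ i ∈ Finset.range (r + 1), Real.exp (l * ((i : ℝ) / r - 1 / 2)) := by
    rw [← Finset.sum_range_reflect]
    apply Finset.sum_congr rfl
    intro i hi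
    have hi : i ≤ r := by have := Finset.mem_range.mp hi; omega
    congr 1
    rw [show r + 1 - 1 - i = r - i by omega, Nat.cast_sub hi]
    field_simp
    ring
  have h2 : ∑ i ∈ Finset.range (r + 1), Real.exp (-l * ((i : ℝ) / r - 1 / 2)) =
      ∑ i ∈ Finset.range (r + 1), Real.cosh (l * ((i : ℝ) / r - 1 / 2)) := by
    have h3 : ∀ i : ℕ, Real.cosh (l * ((i : ℝ) / r - 1 / 2)) =
        (Real.exp (l * ((i : ℝ) / r - 1 / 2)) + Real.exp (-l * ((i : ℝ) / r - 1 / 2))) / 2 := by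
      intro i; rw [Real.cosh_eq, neg_mul]
    simp_rw [h3]
    rw [← Finset.sum_div, Finset.sum_add_distrib, ← h1]; ring
  rw [h2]
  have h4 : ∀ i ∈ Finset.range (r + 1), Real.cosh (l * ((i : ℝ) / r - 1 / 2)) ≤
      Real.exp (l ^ 2 / 8) := by
    intro i hi
    have hi : (i : ℝ) ≤ r := by
      have := Finset.mem_range.mp hi
      exact_mod_cast (by omega : i ≤ r)
    have h5 : Real.cosh (l * ((i : ℝ) / r - 1 / 2)) ≤ Real.cosh (l / 2) := by
      rw [Real.cosh_le_cosh, abs_mul, div_eq_mul_inv l 2, abs_mul]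
      apply mul_le_mul_of_nonneg_left _ (abs_nonneg _)
      have h6 : (i : ℝ) / r ≤ 1 := by rw [div_le_one hr']; exact hi
      have h7 : 0 ≤ (i : ℝ) / r := by positivity
      rw [abs_of_pos (show (0:ℝ) < 2⁻¹ by norm_num), abs_le]
      constructor <;> linarith
    refine h5.trans ((Real.cosh_le_exp_half_sq _).trans (Real.exp_le_exp.mpr ?_))
    nlinarith [sq_nonneg l]
  refine (Finset.sum_le_sum h4).trans ?_
  rw [Finset.sum_const, Finset.card_range, nsmul_eq_mul]
  push_cast; rfl

lemma wt_toF (w : ℕ → ℝ) {m : ℕ} (x : Fin m → ℕ) : wt w (toF x) = ∑ i : Fin m, w i * x i := by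
  rw [wt_eq_sum_range w _ m (toF_ge x), Finset.sum_range]
  apply Finset.sum_congr rfl
  intro i _
  rw [toF_lt]

lemma count_box (m : ℕ) (r : ℕ → ℕ) (hr : ∀ j, j < m → 0 < r j) :
    (((box m r).filter (fun I => wt (fun j => 1 / (r j : ℝ)) I < 9 * m / 20)).card : ℝ) ≤
      Real.exp (-(m : ℝ) / 200) * (box m r).card := by
  classical
  set w : ℕ → ℝ := fun j => 1 / (r j : ℝ) with hw
  have h1 : (((box m r).filter (fun I => wt w I < 9 * m / 20)).card : ℝ) * Real.exp (m / 100) ≤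
      ∑ I ∈ box m r, Real.exp (-(1 / 5) * (wt w I - m / 2)) := by
    rw [← nsmul_eq_mul, ← Finset.sum_const]
    refine le_trans (Finset.sum_le_sum (g := fun I => Real.exp (-(1 / 5) * (wt w I - m / 2))) ?_)
      (Finset.sum_le_sum_of_subset_of_nonneg (Finset.filter_subset _ _)
        (fun _ _ _ => (Real.exp_pos _).le))
    intro I hI
    have := (Finset.mem_filter.mp hI).2
    apply Real.exp_le_exp.mpr
    linarith
  have h2 : ∑ I ∈ box m r, Real.exp (-(1 / 5) * (wt w I - m / 2)) ≤
      (box m r).card * Real.exp (m / 200) := by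
    unfold box
    rw [Finset.sum_map, Finset.card_map, Fintype.card_piFinset]
    have h3 : ∀ x : Fin m → ℕ, Real.exp (-(1 / 5) * (wt w (toF x) - m / 2)) =
        ∏ i : Fin m, Real.exp (-(1 / 5) * ((x i : ℝ) / r i - 1 / 2)) := by
      intro x
      rw [wt_toF, ← Real.exp_sum, ← Finset.mul_sum, Finset.sum_sub_distrib]
      congr 3
      · apply Finset.sum_congr rfl
        intro i _
        rw [hw]; simp only; ring
      · simp; ring
    simp only [Function.Embedding.coeFn_mk]
    simp_rw [h3]
    rw [← Finset.prod_univ_sum (fun i : Fin m => Finset.range (r i + 1))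
      (fun i j => Real.exp (-(1 / 5) * ((j : ℝ) / r i - 1 / 2)))]
    have h4 : ∏ i : Fin m, ∑ j ∈ Finset.range (r i + 1), Real.exp (-(1 / 5) * ((j : ℝ) / r i - 1 / 2))
        ≤ ∏ i : Fin m, (((r i : ℝ) + 1) * Real.exp ((1 / 5) ^ 2 / 8)) := by
      apply Finset.prod_le_prod
      · intro i _; exact Finset.sum_nonneg fun _ _ => (Real.exp_pos _).le
      · intro i _; exact exp_sum_le (r i) (hr i i.2) (1 / 5)
    refine h4.trans ?_
    rw [Finset.prod_mul_distrib, Finset.prod_const, Finset.card_univ, Fintype.card_fin,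
      ← Real.exp_nat_mul]
    push_cast
    simp only [Finset.card_range]
    push_cast
    apply le_of_eq
    congr 2
    ring
  have h5 := h1.trans h2
  have h6 : Real.exp (-(m : ℝ) / 200) = Real.exp (m / 200) / Real.exp (m / 100) := by
    rw [← Real.exp_sub]; congr 1; ring
  rw [h6, div_mul_eq_mul_div, le_div_iff₀ (Real.exp_pos _)]
  linarith

end RothThm


namespace RothThm
open MvPolynomial

theorem aux_poly (α : ℝ) (hα : IsAlgebraic ℤ α) :
    ∃ (m : ℕ) (D : ℝ), 0 < m ∧ 1 ≤ D ∧ ∀ r : ℕ → ℕ, (∀ j, j < m → 0 < r j) →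
      (∀ j, m ≤ j → r j = 0) → ∃ P : MP, IsInt P ∧ P ≠ 0 ∧ DegLe r P ∧
        wN (fun _ => 1) P ≤ D ^ (∑ j ∈ Finset.range m, r j) ∧
        Ord (fun j => 1 / (r j : ℝ)) (9 * m / 20) (T (fun _ => α) P) := by
  classical
  obtain ⟨g, hg0, hgα⟩ := hα
  have hdeg : g.natDegree ≠ 0 := by
    intro h
    rw [Polynomial.eq_C_of_natDegree_eq_zero h] at hgα hg0
    simp at hgα hg0
    exact hg0 hgα
  obtain ⟨e, he⟩ := Nat.exists_eq_succ_of_ne_zero hdeg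
  obtain ⟨A, c, hA1, haA, hc, hcb⟩ := red α g e he hgα
  set a := g.leadingCoeff with ha
  have ha0 : a ≠ 0 := Polynomial.leadingCoeff_ne_zero.mpr hg0
  obtain ⟨m, hm0, hm⟩ : ∃ m : ℕ, 0 < m ∧ (e + 1 : ℝ) * Real.exp (-(m : ℝ) / 200) ≤ 1 / 2 := by
    obtain ⟨m, hm⟩ := exists_nat_gt (200 * (2 * (e + 1 : ℝ)))
    refine ⟨m, ?_, ?_⟩
    · by_contra h
      have : m = 0 := by omega
      subst this
      have : (0:ℝ) ≤ e := Nat.cast_nonneg _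
      simp at hm; linarith
    · have h1 : (2 * (e + 1 : ℝ)) ≤ Real.exp (m / 200) := by
        have := Real.add_one_le_exp ((m : ℝ) / 200)
        linarith
      rw [neg_div, Real.exp_neg]
      have := Real.exp_pos ((m : ℝ) / 200)
      rw [← div_eq_mul_inv, div_le_iff₀ this]
      linarith
  refine ⟨m, 8 * A * (2 * A), hm0, by nlinarith, ?_⟩
  intro r hr hr0
  set S := ∑ j ∈ Finset.range m, r j with hS
  set w : ℕ → ℝ := fun j => 1 / (r j : ℝ) with hw
  set B := box m r with hB
  set E := B.filter (fun I => wt w I < 9 * m / 20) with hE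
  have hBS : (B.card : ℝ) ≤ 2 ^ S := by
    have : B.card ≤ 2 ^ S := by
      rw [hB, card_box, hS, ← Finset.prod_pow_eq_pow_sum]
      apply Finset.prod_le_prod'
      intro j _
      exact Nat.lt_two_pow_self
    exact_mod_cast this
  have hcount : (E.card : ℝ) ≤ Real.exp (-(m : ℝ) / 200) * B.card := count_box m r hr
  have hdegS : ∀ J ∈ B, ∀ I : ℕ →₀ ℕ, (J - I).degree ≤ S := by
    intro J hJ I
    have hJ := (mem_box hr0 J).mp hJ
    rw [degree_eq_sum_range _ m]
    · apply Finset.sum_le_sum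
      intro j _
      have := hJ j
      simp; omega
    · intro j hj
      have := hJ j
      rw [hr0 j hj] at this
      simp; omega
  -- the matrix
  let bn : (ℕ →₀ ℕ) → (ℕ →₀ ℕ) → ℕ := fun J I =>
    ∏ j ∈ (J + I).support, Nat.choose (J j + I j) (I j)
  have hbn : ∀ J I, ((bn J I : ℕ) : ℝ) = bin J I := fun J I => (bin_eq J I).symm
  let ent : (ℕ →₀ ℕ) → ℕ → (ℕ →₀ ℕ) → ℤ := fun I f J =>
    if I ≤ J then (bn (J - I) I : ℤ) * (a ^ (S - (J - I).degree) * c (J - I).degree f) else 0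
  have hent : ∀ I, ∀ J ∈ B, (a : ℝ) ^ S * (T (fun _ => α) (monomial J 1)).coeff I =
      ∑ f ∈ Finset.range (e + 1), (ent I f J : ℝ) * α ^ f := by
    intro I J hJ
    rw [coeff_T_monomial]
    simp only [ent]
    split_ifs with h
    · push_cast
      rw [hbn]
      have h1 : (a : ℝ) ^ S = a ^ (S - (J - I).degree) * a ^ (J - I).degree := by
        rw [← pow_add, Nat.sub_add_cancel (hdegS J hJ I)]
      have h2 := hc (J - I).degree
      calc _ = bin (J - I) I * a ^ (S - (J - I).degree) *
            ((a : ℝ) ^ (J - I).degree * α ^ (J - I).degree) := by rw [h1]; ring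
        _ = _ := by
          rw [h2, Finset.mul_sum]
          apply Finset.sum_congr rfl
          intro f _; ring
    · simp
  have hentb : ∀ I f, ∀ J ∈ B, |(ent I f J : ℝ)| ≤ (2 * A * (2 * A)) ^ S := by
    intro I f J hJ
    simp only [ent]
    split_ifs with h
    · push_cast
      rw [hbn, abs_mul, abs_mul, abs_pow, abs_of_pos (bin_pos _ _)]
      have h1 : bin (J - I) I ≤ 2 ^ S := by
        refine (bin_le _ _).trans ?_
        rw [tsub_add_cancel_of_le h]
        exact mon_le_pow hr0 one_le_two J ((mem_box hr0 J).mp hJ)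
      have h2 : |(a : ℝ)| ^ (S - (J - I).degree) ≤ A ^ S :=
        (pow_le_pow_left₀ (abs_nonneg _) haA _).trans (pow_le_pow_right₀ hA1 (Nat.sub_le _ _))
      have h3 : |(c (J - I).degree f : ℝ)| ≤ (2 * A) ^ S :=
        (hcb _ _).trans (pow_le_pow_right₀ (by linarith) (hdegS J hJ I))
      calc _ ≤ 2 ^ S * (A ^ S * (2 * A) ^ S) := by
            apply mul_le_mul h1 (mul_le_mul h2 h3 (abs_nonneg _) (by positivity)) (by positivity)
              (by positivity)
        _ = _ := by rw [← mul_pow, ← mul_pow, mul_assoc]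
    · simp; positivity
  letI instM : SeminormedAddCommGroup (Matrix (E × Fin (e + 1)) B ℤ) := Matrix.seminormedAddCommGroup
  let M : Matrix (E × Fin (e + 1)) B ℤ := fun x J => ent x.1 x.2 J
  have hcardE : Fintype.card (E × Fin (e + 1)) = E.card * (e + 1) := by
    rw [Fintype.card_prod, Fintype.card_coe, Fintype.card_fin]
  have hcardB : Fintype.card B = B.card := Fintype.card_coe _
  have h0E : (0 : ℕ →₀ ℕ) ∈ E := by
    rw [hE, Finset.mem_filter, hB, mem_box hr0]
    refine ⟨fun j => Nat.zero_le _, ?_⟩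
    rw [wt_zero]; positivity
  have hEpos : 0 < E.card := Finset.card_pos.mpr ⟨0, h0E⟩
  have hBpos : 0 < B.card := Finset.card_pos.mpr ⟨0, (Finset.mem_filter.mp h0E).1⟩
  have hBpos' : (0 : ℝ) < B.card := by exact_mod_cast hBpos
  have hhalf : 2 * ((E.card * (e + 1) : ℕ) : ℝ) ≤ B.card := by
    push_cast
    have : (0 : ℝ) ≤ e + 1 := by positivity
    nlinarith [mul_le_mul_of_nonneg_right hcount this]
  have hlt : Fintype.card (E × Fin (e + 1)) < Fintype.card B := by
    rw [hcardE, hcardB]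
    have : 2 * (E.card * (e + 1)) ≤ B.card := by exact_mod_cast hhalf
    have : 0 < E.card * (e + 1) := by positivity
    omega
  obtain ⟨t, ht0, htM, htn⟩ := Int.Matrix.exists_ne_zero_int_vec_norm_le M hlt
    (by rw [hcardE]; positivity)
  rw [hcardE, hcardB] at htn
  have hMn : ‖M‖ ≤ (2 * A * (2 * A)) ^ S := by
    rw [Matrix.norm_le_iff (by positivity)]
    intro x J
    rw [Int.norm_eq_abs]
    exact hentb _ _ _ J.2
  have h1A : (1 : ℝ) ≤ (2 * A * (2 * A)) ^ S := one_le_pow₀ (by nlinarith)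
  have htn' : ‖t‖ ≤ 2 ^ S * (2 * A * (2 * A)) ^ S := by
    have h1 : (1 : ℝ) ≤ B.card * max 1 ‖M‖ := by
      have : (1 : ℝ) ≤ B.card := by exact_mod_cast hBpos
      have := le_max_left 1 ‖M‖
      nlinarith
    refine htn.trans ((Real.rpow_le_self_of_one_le h1 ?_).trans ?_)
    · rw [div_le_one]
      · linarith
      · have : (0 : ℝ) < ((E.card * (e + 1) : ℕ) : ℝ) := by positivity
        linarith
    · exact mul_le_mul hBS (max_le h1A hMn) (by positivity) (by positivity)
  set P : MP := ∑ J : B, monomial (J : ℕ →₀ ℕ) (t J : ℝ) with hP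
  have hPc : ∀ J : B, P.coeff J = t J := by
    intro J
    rw [hP, coeff_sum, Finset.sum_eq_single J]
    · simp
    · intro K _ hK
      rw [coeff_monomial, if_neg (fun h => hK (Subtype.ext h))]
    · intro h; exact absurd (Finset.mem_univ _) h
  have hPc' : ∀ J, J ∉ B → P.coeff J = 0 := by
    intro J hJ
    rw [hP, coeff_sum]
    apply Finset.sum_eq_zero
    intro K _
    rw [coeff_monomial, if_neg]
    rintro rfl
    exact hJ K.2
  have hPdeg : DegLe r P := by
    intro I hI
    by_cases h : I ∈ B
    · exact (mem_box hr0 I).mp h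
    · exact absurd (hPc' I h) hI
  refine ⟨P, ?_, ?_, hPdeg, ?_, ?_⟩
  · intro I
    by_cases h : I ∈ B
    · exact ⟨t ⟨I, h⟩, hPc ⟨I, h⟩⟩
    · exact ⟨0, by rw [hPc' I h]; simp⟩
  · intro h
    apply ht0
    funext J
    have := hPc J
    rw [h, coeff_zero] at this
    simp only [Pi.zero_apply]
    exact_mod_cast this.symm
  · rw [hP]
    refine (wN_sum_le (fun _ => zero_le_one) _ _).trans ?_
    have : ∀ J ∈ (Finset.univ : Finset B), wN (fun _ => 1) (monomial (J : ℕ →₀ ℕ) (t J : ℝ)) ≤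
        2 ^ S * (2 * A * (2 * A)) ^ S := by
      intro J _
      rw [wN_monomial, mon_one, mul_one]
      have := norm_le_pi_norm t J
      rw [Int.norm_eq_abs] at this
      exact this.trans htn'
    refine (Finset.sum_le_sum this).trans ?_
    rw [Finset.sum_const, Finset.card_univ, hcardB, nsmul_eq_mul]
    calc _ ≤ 2 ^ S * (2 ^ S * (2 * A * (2 * A)) ^ S) := by gcongr
      _ = _ := by rw [← mul_pow, ← mul_pow]; ring
  · intro I hI
    by_contra hlt'
    push Not at hlt'
    apply hI
    have hIE : I ∈ E := by
      rw [hE, Finset.mem_filter, hB, mem_box hr0]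
      exact ⟨hPdeg.T _ I hI, hlt'⟩
    have h1 : (a : ℝ) ^ S * (T (fun _ => α) P).coeff I = 0 := by
      have h2 : T (fun _ => α) P = ∑ J : B, C (t J : ℝ) * T (fun _ => α) (monomial (J : ℕ →₀ ℕ) 1) := by
        rw [hP, map_sum]
        apply Finset.sum_congr rfl
        intro J _
        rw [← T_C (fun _ => α) (t J : ℝ), ← map_mul, C_mul_monomial, mul_one]
      rw [h2, coeff_sum, Finset.mul_sum]
      have h3 : ∀ J : B, (a : ℝ) ^ S * (C (t J : ℝ) * T (fun _ => α) (monomial (J : ℕ →₀ ℕ) 1)).coeff I =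
          ∑ f ∈ Finset.range (e + 1), ((ent I f J * t J : ℤ) : ℝ) * α ^ f := by
        intro J
        rw [coeff_C_mul]
        calc _ = t J * ((a : ℝ) ^ S * (T (fun _ => α) (monomial (J : ℕ →₀ ℕ) 1)).coeff I) := by ring
          _ = _ := by
            rw [hent I J J.2, Finset.mul_sum]
            apply Finset.sum_congr rfl
            intro f _
            push_cast; ring
      simp_rw [h3]
      rw [Finset.sum_comm]
      apply Finset.sum_eq_zero
      intro f hf
      rw [← Finset.sum_mul]
      have h4 := congrFun htM (⟨I, hIE⟩, ⟨f, Finset.mem_range.mp hf⟩)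
      rw [Matrix.mulVec, dotProduct] at h4
      simp only [M, Pi.zero_apply] at h4
      have h5 : ∑ J : B, ((ent I f J * t J : ℤ) : ℝ) = 0 := by exact_mod_cast h4
      rw [h5, zero_mul]
    rcases mul_eq_zero.mp h1 with h | h
    · exact absurd h (pow_ne_zero _ (by exact_mod_cast ha0))
    · exact h

end RothThm


namespace RothThm
open MvPolynomial

lemma int_coeff_T {m : ℕ} {r : ℕ → ℕ} (hr : ∀ j, m ≤ j → r j = 0) {P : MP} (hP : DegLe r P)
    (hisint : IsInt P) (p : ℕ → ℤ) (q : ℕ → ℕ) (β : ℕ → ℝ) (hq : ∀ j, j < m → 0 < q j)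
    (hβ : ∀ j, j < m → β j = p j / q j) (I : ℕ →₀ ℕ) :
    ∃ z : ℤ, (∏ j ∈ Finset.range m, (q j : ℝ) ^ r j) * (T β P).coeff I = z := by
  rw [coeff_T, Finset.mul_sum]
  apply int_sum
  intro K hK
  obtain ⟨z, hz⟩ := hisint.hasse I K
  have hKr := hP.hasse I K (mem_support_iff.mp hK)
  rw [hz, mon_eq_prod_range β K m (fun j hj => by
    have := hKr j; rw [hr j hj] at this; omega)]
  refine ⟨z * ∏ j ∈ Finset.range m, ((p j) ^ K j * (q j : ℤ) ^ (r j - K j)), ?_⟩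
  push_cast
  rw [mul_left_comm, ← Finset.prod_mul_distrib]
  congr 1
  apply Finset.prod_congr rfl
  intro j hj
  have hj := Finset.mem_range.mp hj
  have hqj : (q j : ℝ) ≠ 0 := by exact_mod_cast (hq j hj).ne'
  rw [hβ j hj, div_pow]
  have : (q j : ℝ) ^ r j = (q j : ℝ) ^ (r j - K j) * (q j : ℝ) ^ K j := by
    rw [← pow_add, Nat.sub_add_cancel (hKr j)]
  rw [this]
  field_simp

/-- the exponents -/
noncomputable def rr (m : ℕ) (N : ℕ) (l : ℕ → ℝ) (j : ℕ) : ℕ :=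
  if j < m then ⌈(N : ℝ) * l 0 / l j⌉₊ else 0

theorem roth_weak (α : ℝ) (hα : IsAlgebraic ℤ α) :
    ∃ X : ℝ, ∀ (p : ℤ) (q : ℕ), 0 < q → IsCoprime p (q : ℤ) →
      |α - p / q| ≤ Real.exp (-(5 / 2) * Real.log q) → Real.log q ≤ X := by
  by_contra hcon
  push Not at hcon
  obtain ⟨m, D, hm, hD, haux⟩ := aux_poly α hα
  obtain ⟨ω, hω, hω1, hroth⟩ := roth_lemma m (1 / 100) (by norm_num) (by norm_num)
  choose pf qf hq0 hcop happ hbig using hcon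
  set G : ℝ := 2 * (1 + |α|) * D with hG
  have hG1 : 1 ≤ G := by
    have := abs_nonneg α
    rw [hG]; nlinarith
  have hlogG : 0 ≤ Real.log G := Real.log_nonneg hG1
  have hlogD : 0 ≤ Real.log D := Real.log_nonneg hD
  have hlog8 : 0 ≤ Real.log 8 := Real.log_nonneg (by norm_num)
  set X0 : ℝ := m * Real.log 8 / ω + m * Real.log D / ω + 100 * Real.log G + 1 with hX0
  have hm' : (0 : ℝ) < m := by exact_mod_cast hm
  have hm1 : (1 : ℝ) ≤ m := by exact_mod_cast hm
  have ht1 : 0 ≤ m * Real.log 8 / ω := by positivity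
  have ht2 : 0 ≤ m * Real.log D / ω := by positivity
  -- thresholds
  let Y : ℕ → ℝ := fun j => Nat.rec X0 (fun _ y => 2 / ω * Real.log (qf y)) j
  let p : ℕ → ℤ := fun j => pf (Y j)
  let q : ℕ → ℕ := fun j => qf (Y j)
  set l : ℕ → ℝ := fun j => Real.log (q j) with hl
  have hl0 : X0 < l 0 := hbig X0
  have hls : ∀ j, 2 / ω * l j < l (j + 1) := fun j => hbig (Y (j + 1))
  have hlpos : ∀ j, 0 < l j := by
    intro j
    induction j with
    | zero => linarith
    | succ j ih => exact lt_trans (by positivity) (hls j)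
  have h2ω : 1 ≤ 2 / ω := by rw [le_div_iff₀ hω]; linarith
  have hstep : ∀ j, l j ≤ l (j + 1) := fun j => by
    have := hls j; nlinarith [hlpos j]
  have hmono : Monotone l := monotone_nat_of_le_succ hstep
  have hgap : ∀ i j, i < j → 2 / ω * l i ≤ l j := by
    intro i j hij
    exact (hls i).le.trans (hmono hij)
  -- N
  obtain ⟨N, hN⟩ := exists_nat_gt (100 * l m / l 0)
  have hNpos : (0 : ℝ) < N := lt_of_le_of_lt (by have := hlpos m; have := hlpos 0; positivity) hN
  set L : ℝ := N * l 0 with hL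
  have hLpos : 0 < L := mul_pos hNpos (hlpos 0)
  have hlL : ∀ j, j < m → l j ≤ L / 100 := by
    intro j hj
    have h1 := hmono hj.le
    rw [div_lt_iff₀ (hlpos 0)] at hN
    linarith
  set r := rr m N l with hr
  have hr0 : ∀ j, m ≤ j → r j = 0 := fun j hj => by
    simp [hr, rr, Nat.not_lt.mpr hj]
  have hrj : ∀ j, j < m → r j = ⌈L / l j⌉₊ := fun j hj => by simp [hr, rr, hj, hL]
  have hrlow : ∀ j, j < m → L ≤ r j * l j := by
    intro j hj
    rw [hrj j hj, ← div_le_iff₀ (hlpos j)]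
    exact Nat.le_ceil _
  have hrup : ∀ j, j < m → r j * l j ≤ 101 / 100 * L := by
    intro j hj
    have h1 : (r j : ℝ) < L / l j + 1 := by
      rw [hrj j hj]
      exact Nat.ceil_lt_add_one (div_nonneg hLpos.le (hlpos j).le)
    have h2 := mul_le_mul_of_nonneg_right h1.le (hlpos j).le
    rw [add_mul, div_mul_cancel₀ _ (hlpos j).ne'] at h2
    have := hlL j hj
    linarith
  have hrpos : ∀ j, j < m → 0 < r j := by
    intro j hj
    rw [hrj j hj, Nat.ceil_pos]
    exact div_pos hLpos (hlpos j)
  have hratio : ∀ i j, i < j → j < m → (r j : ℝ) ≤ ω * r i := by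
    intro i j hij hj
    have h1 := hrup j hj
    have h2 := hrlow i (hij.trans hj)
    have h3 := hgap i j hij
    have hri : (0 : ℝ) ≤ r i := Nat.cast_nonneg _
    have h4 : (r j : ℝ) * (2 / ω * l i) ≤ r j * l j :=
      mul_le_mul_of_nonneg_left h3 (Nat.cast_nonneg _)
    have h5 : (r j : ℝ) * (2 / ω * l i) ≤ 2 * (r i * l i) := by linarith
    have h6 : (r j : ℝ) * (2 / ω * l i) = (2 * l i) * (r j / ω) := by ring
    rw [h6] at h5
    have h7 : (2 * l i) * ((r j : ℝ) / ω) ≤ (2 * l i) * r i := by linarith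
    have h8 := le_of_mul_le_mul_left h7 (by have := hlpos i; positivity)
    rw [div_le_iff₀ hω] at h8
    linarith
  have hrN : ∀ j, j < m → r j ≤ N := by
    intro j hj
    rw [hrj j hj]
    apply Nat.ceil_le.mpr
    rw [div_le_iff₀ (hlpos j), hL]
    exact mul_le_mul_of_nonneg_left (hmono (Nat.zero_le j)) hNpos.le
  set S := ∑ j ∈ Finset.range m, r j with hS
  have hSN : (S : ℝ) ≤ m * N := by
    have : S ≤ m * N := by
      calc S ≤ ∑ j ∈ Finset.range m, N := Finset.sum_le_sum fun j hj => hrN j (Finset.mem_range.mp hj)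
        _ = _ := by simp
    exact_mod_cast this
  have hSlog : ∀ y c : ℝ, 1 ≤ y → 0 < c → m * Real.log y / c ≤ l 0 → S * Real.log y ≤ c * L := by
    intro y c hy hc h
    rw [div_le_iff₀ hc] at h
    have h1 := Real.log_nonneg hy
    calc (S : ℝ) * Real.log y ≤ m * N * Real.log y := by gcongr
      _ = N * (m * Real.log y) := by ring
      _ ≤ N * (l 0 * c) := by gcongr
      _ = _ := by rw [hL]; ring
  have hpowS : ∀ y c : ℝ, 1 ≤ y → 0 < c → m * Real.log y / c ≤ l 0 → y ^ S ≤ Real.exp (c * L) := by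
    intro y c hy hc h
    rw [← Real.exp_log (show 0 < y by linarith), ← Real.exp_nat_mul]
    exact Real.exp_le_exp.mpr (hSlog y c hy hc h)
  obtain ⟨P, hPint, hPne, hPdeg, hPN, hPord⟩ := haux r hrpos hr0
  let β : ℕ → ℝ := fun j => if j < m then (p j : ℝ) / q j else α
  have hβ : ∀ j, j < m → β j = p j / q j := fun j hj => by simp [β, hj]
  have hPN2 : wN (fun _ => 1) P ≤ Real.exp (ω * L) :=
    hPN.trans (hpowS D ω hD hω (by linarith))
  obtain ⟨I, hI, hIw⟩ := hroth r p q β L P hrpos hr0 hratio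
    (fun j hj => ⟨hq0 _, hcop _, hβ j hj⟩) hLpos.le hrlow
    (by
      have := hSlog 8 ω (by norm_num) hω (by linarith)
      rw [hS] at this; push_cast at this; exact this)
    hPint hPne hPdeg hPN2
  set c := (T β P).coeff I with hc
  have hIr := hPdeg.T β I hI
  have hIm : ∀ j, m ≤ j → I j = 0 := fun j hj => by
    have := hIr j; rw [hr0 j hj] at this; omega
  have hqpos : ∀ j, (0 : ℝ) < q j := fun j => by exact_mod_cast hq0 (Y j)
  -- lower bound
  have hlower : Real.exp (-(101 / 100 * L * m)) ≤ |c| := by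
    obtain ⟨z, hz⟩ := int_coeff_T hr0 hPdeg hPint p q β (fun j _ => hq0 _) hβ I
    have hprod : (∏ j ∈ Finset.range m, (q j : ℝ) ^ r j) ≤ Real.exp (101 / 100 * L * m) := by
      have h1 : ∀ j ∈ Finset.range m, (q j : ℝ) ^ r j ≤ Real.exp (101 / 100 * L) := by
        intro j hj
        rw [← Real.exp_log (hqpos j), ← Real.exp_nat_mul]
        exact Real.exp_le_exp.mpr (hrup j (Finset.mem_range.mp hj))
      refine (Finset.prod_le_prod (fun j _ => by positivity) h1).trans ?_
      rw [Finset.prod_const, Finset.card_range, ← Real.exp_nat_mul]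
      apply le_of_eq; congr 1; ring
    have hprod0 : 0 < ∏ j ∈ Finset.range m, (q j : ℝ) ^ r j :=
      Finset.prod_pos fun j _ => pow_pos (hqpos j) _
    have hz0 : z ≠ 0 := by
      intro h
      rw [h, Int.cast_zero] at hz
      exact (mul_ne_zero hprod0.ne' hI) hz
    have h1 : (1 : ℝ) ≤ |(z : ℝ)| := by exact_mod_cast Int.one_le_abs hz0
    rw [← hz, abs_mul, abs_of_pos hprod0] at h1
    rw [Real.exp_neg, inv_le_iff_one_le_mul₀ (Real.exp_pos _)]
    refine h1.trans ?_
    rw [mul_comm]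
    exact mul_le_mul_of_nonneg_left hprod (abs_nonneg _)
  -- upper bound
  let ρ : ℕ → ℝ := fun j => Real.exp (-(5 / 2) * l j)
  have hρ0 : ∀ j, 0 ≤ ρ j := fun j => (Real.exp_pos _).le
  have hmonρ : ∀ K : ℕ →₀ ℕ, (∀ j, m ≤ j → K j = 0) →
      mon ρ K = Real.exp (-(5 / 2) * ∑ j ∈ Finset.range m, (K j : ℝ) * l j) := by
    intro K hK
    rw [mon_eq_prod_range ρ K m hK, Finset.mul_sum, Real.exp_sum]
    apply Finset.prod_congr rfl
    intro j _
    rw [← Real.exp_nat_mul]; congr 1; ring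
  have hwtsum : ∀ K : ℕ →₀ ℕ, (∀ j, m ≤ j → K j = 0) →
      L * wt (fun j => 1 / (r j : ℝ)) K ≤ ∑ j ∈ Finset.range m, (K j : ℝ) * l j ∧
      ∑ j ∈ Finset.range m, (K j : ℝ) * l j ≤ 101 / 100 * L * wt (fun j => 1 / (r j : ℝ)) K := by
    intro K hK
    rw [wt_eq_sum_range _ K m hK, Finset.mul_sum, Finset.mul_sum]
    have key : ∀ j, j < m → (K j : ℝ) * l j = (r j * l j) * (1 / (r j : ℝ) * K j) := by
      intro j hj
      have : (r j : ℝ) ≠ 0 := by exact_mod_cast (hrpos j hj).ne'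
      field_simp
    constructor
    · apply Finset.sum_le_sum
      intro j hj
      have hj := Finset.mem_range.mp hj
      rw [key j hj]
      exact mul_le_mul_of_nonneg_right (hrlow j hj) (by positivity)
    · apply Finset.sum_le_sum
      intro j hj
      have hj := Finset.mem_range.mp hj
      rw [key j hj]
      exact mul_le_mul_of_nonneg_right (hrup j hj) (by positivity)
  let γ : ℕ → ℝ := fun j => β j - α
  have hTT : T β P = T γ (T (fun _ => α) P) := by
    rw [T_T]; congr 2; funext j; simp [γ]
  have hup1 : |c| * mon ρ I ≤ wN (fun j => ρ j + |γ j|) (T (fun _ => α) P) := by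
    refine (coeff_le_wN hρ0 (T β P) I).trans ?_
    rw [hTT]
    exact wN_T_le hρ0 _ _
  have hρβ : ∀ j, ρ j + |γ j| ≤ 2 * ρ j := by
    intro j
    have : |γ j| ≤ ρ j := by
      by_cases hj : j < m
      · simp only [γ]
        rw [hβ j hj, abs_sub_comm]
        exact happ (Y j)
      · simp [γ, β, hj, hρ0]
    linarith
  have hup2 : wN (fun j => ρ j + |γ j|) (T (fun _ => α) P) ≤
      2 ^ S * Real.exp (-(5 / 2) * (L * (9 * m / 20))) * wN (fun _ => 1) (T (fun _ => α) P) := by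
    unfold wN
    rw [Finset.mul_sum]
    apply Finset.sum_le_sum
    intro J hJ
    have hJ := mem_support_iff.mp hJ
    have hJr := hPdeg.T _ J hJ
    have hJm : ∀ j, m ≤ j → J j = 0 := fun j hj => by
      have := hJr j; rw [hr0 j hj] at this; omega
    rw [mon_one, mul_one, mul_comm]
    apply mul_le_mul_of_nonneg_right _ (abs_nonneg _)
    have h1 : mon (fun j => ρ j + |γ j|) J ≤ mon (fun _ => 2) J * mon ρ J := by
      rw [mon_eq_prod_range _ J m hJm, mon_eq_prod_range _ J m hJm, mon_eq_prod_range _ J m hJm,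
        ← Finset.prod_mul_distrib]
      apply Finset.prod_le_prod
      · intro j _
        have := hρ0 j
        positivity
      · intro j _
        rw [← mul_pow]
        exact pow_le_pow_left₀ (add_nonneg (hρ0 j) (abs_nonneg _)) (hρβ j) _
    refine h1.trans ?_
    apply mul_le_mul (mon_le_pow hr0 one_le_two J hJr) _ (mon_nonneg hρ0 J) (by positivity)
    rw [hmonρ J hJm]
    apply Real.exp_le_exp.mpr
    have h2 := (hwtsum J hJm).1
    have h3 := mul_le_mul_of_nonneg_left (hPord J hJ) hLpos.le
    linarith
  have hup3 : wN (fun _ => 1) (T (fun _ => α) P) ≤ (1 + |α|) ^ S * D ^ S := by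
    refine (wN_T_le (fun _ => zero_le_one) _ P).trans ?_
    refine (wN_le_pow_mul hr0 (by linarith [abs_nonneg α]) hPdeg).trans ?_
    exact mul_le_mul_of_nonneg_left hPN (by positivity)
  have hup4 : |c| * mon ρ I ≤ Real.exp (1 / 100 * m * L) * Real.exp (-(5 / 2) * (L * (9 * m / 20))) := by
    refine hup1.trans (hup2.trans ?_)
    have h1 := hpowS G (1 / 100 * m) hG1 (by positivity) (by
      have : m * Real.log G / (1 / 100 * m) = 100 * Real.log G := by field_simp
      rw [this]; linarith)
    calc _ ≤ 2 ^ S * Real.exp (-(5 / 2) * (L * (9 * m / 20))) * ((1 + |α|) ^ S * D ^ S) := by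
          gcongr
      _ = G ^ S * Real.exp (-(5 / 2) * (L * (9 * m / 20))) := by
          rw [hG, mul_pow, mul_pow]; ring
      _ ≤ _ := by gcongr
  have hmonI : Real.exp (-(5 / 2) * (101 / 100 * L * (1 / 100))) ≤ mon ρ I := by
    rw [hmonρ I hIm]
    apply Real.exp_le_exp.mpr
    have h2 := (hwtsum I hIm).2
    have h3 := mul_le_mul_of_nonneg_left hIw.le (show 0 ≤ 101 / 100 * L by positivity)
    linarith
  have hfinal := (mul_le_mul hlower hmonI (Real.exp_pos _).le (abs_nonneg _)).trans hup4
  rw [← Real.exp_add, ← Real.exp_add, Real.exp_le_exp] at hfinal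
  nlinarith [mul_le_mul_of_nonneg_left hm1 hLpos.le]

end RothThm


namespace RothThm

theorem roth_bound (α : ℝ) (hα : IsAlgebraic ℤ α) (hirr : Irrational α) :
    ∃ c : ℝ, 0 < c ∧ ∀ (q : ℕ) (p : ℤ), 0 < q → c * (q : ℝ) ^ (-(3 / 2) : ℝ) ≤ |q * α - p| := by
  obtain ⟨X, hX⟩ := roth_weak α hα
  have hne : ∀ (q : ℕ) (p : ℤ), 0 < q → 0 < |q * α - p| := by
    intro q p hq
    rw [abs_pos, sub_ne_zero]
    exact (hirr.natCast_mul hq.ne').ne_int p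
  obtain ⟨c, hc0, hc1, hc⟩ : ∃ c : ℝ, 0 < c ∧ c ≤ 1 ∧
      ∀ (q : ℕ) (p : ℤ), 0 < q → Real.log q ≤ X → c ≤ |q * α - p| := by
    obtain ⟨Q, hQ⟩ := exists_nat_gt (Real.exp X)
    have hfin : ∀ Q : ℕ, ∃ c : ℝ, 0 < c ∧ c ≤ 1 ∧
        ∀ (q : ℕ) (p : ℤ), 0 < q → q < Q → c ≤ |q * α - p| := by
      intro Q
      induction Q with
      | zero => exact ⟨1, one_pos, le_rfl, fun q p _ h => by omega⟩
      | succ Q ih =>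
        obtain ⟨c, hc0, hc1, hc⟩ := ih
        by_cases hQ : Q = 0
        · refine ⟨c, hc0, hc1, fun q p h1 h2 => by omega⟩
        · refine ⟨min c |Q * α - round (Q * α)|, lt_min hc0 (hne Q _ (by omega)),
            (min_le_left _ _).trans hc1, ?_⟩
          intro q p h1 h2
          rcases Nat.lt_succ_iff_lt_or_eq.mp h2 with h | h
          · exact (min_le_left _ _).trans (hc q p h1 h)
          · subst h
            exact (min_le_right _ _).trans (round_le _ _)
    obtain ⟨c, hc0, hc1, hc⟩ := hfin Q
    refine ⟨c, hc0, hc1, fun q p h1 h2 => hc q p h1 ?_⟩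
    have hq : (0 : ℝ) < q := by exact_mod_cast h1
    rw [Real.log_le_iff_le_exp hq] at h2
    exact_mod_cast h2.trans_lt hQ
  refine ⟨c, hc0, ?_⟩
  intro q p hq
  -- reduce to lowest terms
  have hqz : (q : ℤ) ≠ 0 := by exact_mod_cast hq.ne'
  set x : ℚ := p / q with hx
  have hqx0 : 0 < x.den := x.pos
  have hqx : (x.den : ℤ) ∣ q := by
    have hxx : x = Rat.divInt p q := by rw [hx, Rat.divInt_eq_div]; push_cast; rfl
    rw [hxx]; exact Rat.den_dvd p q
  obtain ⟨g, hg⟩ := hqx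
  have hgpos : 0 < g := by
    have h1 : (0 : ℤ) < q := by exact_mod_cast hq
    rw [hg] at h1
    exact pos_of_mul_pos_right h1 (by positivity)
  have hcop : IsCoprime x.num (x.den : ℤ) := by
    rw [Int.isCoprime_iff_nat_coprime]
    simpa using x.reduced
  have hpg : (p : ℝ) = x.num * g := by
    have h1 : (x : ℝ) = p / q := by rw [hx]; push_cast; rfl
    have h2 : (x : ℝ) = x.num / x.den := by exact_mod_cast (Rat.num_div_den x).symm
    have h3 : (q : ℝ) = x.den * g := by exact_mod_cast hg
    have h4 : (x.den : ℝ) ≠ 0 := by exact_mod_cast hqx0.ne'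
    have h5 : (g : ℝ) ≠ 0 := by exact_mod_cast hgpos.ne'
    rw [h2, h3] at h1
    field_simp at h1
    linarith
  have hqg : (q : ℝ) = x.den * g := by exact_mod_cast hg
  have hg1 : (1 : ℝ) ≤ g := by exact_mod_cast hgpos
  have hd1 : (1 : ℝ) ≤ x.den := by exact_mod_cast hqx0
  have hd0 : (0 : ℝ) < x.den := by linarith
  have hfac : |q * α - p| = g * |x.den * α - x.num| := by
    rw [hpg, hqg, ← abs_of_pos (show (0 : ℝ) < g by linarith), ← abs_mul,
      abs_of_pos (show (0 : ℝ) < g by linarith)]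
    congr 1; ring
  have hmain : c * (x.den : ℝ) ^ (-(3 / 2) : ℝ) ≤ |x.den * α - x.num| := by
    by_cases hlog : Real.log x.den ≤ X
    · refine le_trans ?_ (hc x.den x.num hqx0 hlog)
      have : (x.den : ℝ) ^ (-(3 / 2) : ℝ) ≤ 1 := Real.rpow_le_one_of_one_le_of_nonpos hd1 (by norm_num)
      nlinarith
    · have h1 : Real.exp (-(5 / 2) * Real.log x.den) < |α - x.num / x.den| := by
        by_contra h
        exact hlog (hX x.num x.den hqx0 hcop (not_lt.mp h))
      have h2 : |(x.den : ℝ) * α - x.num| = x.den * |α - x.num / x.den| := by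
        rw [← abs_of_pos hd0, ← abs_mul, abs_of_pos hd0]
        congr 1; field_simp
      rw [h2]
      have h3 : (x.den : ℝ) ^ (-(3 / 2) : ℝ) = x.den * Real.exp (-(5 / 2) * Real.log x.den) := by
        rw [Real.rpow_def_of_pos hd0]
        nth_rewrite 2 [← Real.exp_log hd0]
        rw [← Real.exp_add]; congr 1; ring
      rw [h3]
      have h4 : 0 ≤ (x.den : ℝ) * Real.exp (-(5 / 2) * Real.log x.den) := by positivity
      have h5 := mul_le_mul_of_nonneg_left h1.le hd0.le
      nlinarith
  rw [hfac]
  have h6 : (q : ℝ) ^ (-(3 / 2) : ℝ) ≤ (x.den : ℝ) ^ (-(3 / 2) : ℝ) := by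
    apply Real.rpow_le_rpow_of_nonpos hd0 _ (by norm_num)
    rw [hqg]; nlinarith
  have h7 := abs_nonneg ((x.den : ℝ) * α - x.num)
  nlinarith

lemma summable_g : Summable (fun k : ℤ => ((|k| : ℤ) + 1 : ℝ) ^ (-(7 / 6) : ℝ)) := by
  have h : Summable (fun n : ℕ => ((n : ℝ) + 1) ^ (-(7 / 6) : ℝ)) := by
    have h1 : Summable (fun n : ℕ => (n : ℝ) ^ (-(7 / 6) : ℝ)) :=
      Real.summable_nat_rpow.mpr (by norm_num)
    have := (summable_nat_add_iff 1).mpr h1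
    simpa using this
  apply Summable.of_nat_of_neg
  · simpa using h
  · simpa using h

/-- signed distance of `m z - 1/2` from the nearest integer -/
noncomputable def vv (z : ℝ) (m : ℕ) : ℝ := (m * z - 1 / 2) - round (m * z - 1 / 2)

lemma abs_cos_ge (z : ℝ) (m : ℕ) : 2 * |vv z m| ≤ |Real.cos (Real.pi * m * z)| := by
  have h1 : Real.pi * m * z = (Real.pi * vv z m + Real.pi / 2) + (round (m * z - 1 / 2) : ℤ) * Real.pi := by
    unfold vv; ring
  rw [h1, Real.cos_add_int_mul_pi, abs_mul, abs_zpow, abs_neg, abs_one, one_zpow, one_mul,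
    Real.cos_add_pi_div_two, abs_neg]
  have h2 : |vv z m| ≤ 1 / 2 := abs_sub_round _
  have h3 := Real.mul_abs_le_abs_sin (x := Real.pi * vv z m) (by
    rw [abs_mul, abs_of_pos Real.pi_pos]; nlinarith [Real.pi_pos])
  refine le_trans (le_of_eq ?_) h3
  rw [abs_mul, abs_of_pos Real.pi_pos]
  field_simp

theorem summable_sec (z : ℝ) (hα : IsAlgebraic ℤ z) (hirr : Irrational z) :
    Summable (fun m : ℕ => 1 / |Real.cos (Real.pi * (m + 1) * z)| / ((m : ℝ) + 1) ^ 2) := by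
  obtain ⟨c, hc, hb⟩ := roth_bound z hα hirr
  let i : ℕ → ℕ := fun m => Nat.log 2 (m + 1)
  let η : ℕ → ℝ := fun i => c * ((2 : ℝ) ^ i) ^ (-(3 / 2) : ℝ)
  have hη : ∀ i, 0 < η i := fun i => by positivity
  have hi1 : ∀ m : ℕ, (2 : ℝ) ^ i m ≤ (m : ℝ) + 1 := fun m => by
    have := Nat.pow_log_le_self 2 (Nat.succ_ne_zero m)
    exact_mod_cast this
  have hi2 : ∀ m : ℕ, (m : ℝ) + 1 < 2 ^ (i m) * 2 := fun m => by
    have := Nat.lt_pow_succ_log_self (b := 2) (by norm_num) (m + 1)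
    rw [pow_succ] at this
    exact_mod_cast this
  let v : ℕ → ℝ := fun m => vv z (m + 1)
  -- lower bound
  have hvlow : ∀ m, η (i m) / 16 ≤ |v m| := by
    intro m
    have h1 := hb (2 * (m + 1)) (2 * round (((m + 1 : ℕ) : ℝ) * z - 1 / 2) + 1) (by omega)
    have h2 : ((2 * (m + 1) : ℕ) : ℝ) * z - ((2 * round (((m + 1 : ℕ) : ℝ) * z - 1 / 2) + 1 : ℤ) : ℝ)
        = 2 * v m := by
      simp only [v, vv]; push_cast; ring
    rw [h2, abs_mul, abs_of_pos (show (0 : ℝ) < 2 by norm_num)] at h1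
    have h3 : ((2 : ℝ) ^ i m * 4) ^ (-(3 / 2) : ℝ) ≤ ((2 * (m + 1) : ℕ) : ℝ) ^ (-(3 / 2) : ℝ) := by
      apply Real.rpow_le_rpow_of_nonpos (by positivity) _ (by norm_num)
      have := hi2 m
      push_cast; linarith
    have h4 : ((2 : ℝ) ^ i m * 4) ^ (-(3 / 2) : ℝ) = ((2 : ℝ) ^ i m) ^ (-(3 / 2) : ℝ) / 8 := by
      rw [Real.mul_rpow (by positivity) (by norm_num)]
      have : (4 : ℝ) ^ (-(3 / 2) : ℝ) = 1 / 8 := by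
        rw [show (4 : ℝ) = 2 ^ (2 : ℝ) by norm_num, ← Real.rpow_mul (by norm_num),
          show (2 : ℝ) * -(3 / 2) = -(3 : ℕ) by norm_num, Real.rpow_neg (by norm_num),
          Real.rpow_natCast]
        norm_num
      rw [this]; ring
    rw [h4] at h3
    have h5 := mul_le_mul_of_nonneg_left h3 hc.le
    simp only [η]
    linarith
  let k : ℕ → ℤ := fun m => ⌊v m / η (i m)⌋
  let ι : ℕ → ℕ × ℤ := fun m => (i m, k m)
  have hinj : Function.Injective ι := by
    have key : ∀ m m', m < m' → ι m ≠ ι m' := by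
      intro m m' hlt heq
      have e1 : i m = i m' := congrArg Prod.fst heq
      have e2 : k m = k m' := congrArg Prod.snd heq
      simp only [k] at e2
      have h1 : |v m / η (i m) - v m' / η (i m')| < 1 := Int.abs_sub_lt_one_of_floor_eq_floor e2
      rw [← e1, ← sub_div, abs_div, abs_of_pos (hη _), div_lt_one (hη _), abs_sub_comm] at h1
      have h2 := hb (m' - m) (round (((m' + 1 : ℕ) : ℝ) * z - 1 / 2) - round (((m + 1 : ℕ) : ℝ) * z - 1 / 2))
        (by omega)
      have h3 : ((m' - m : ℕ) : ℝ) * z - ((round (((m' + 1 : ℕ) : ℝ) * z - 1 / 2) -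
          round (((m + 1 : ℕ) : ℝ) * z - 1 / 2) : ℤ) : ℝ) = v m' - v m := by
        simp only [v, vv]; push_cast [Nat.cast_sub hlt.le]; ring
      rw [h3] at h2
      have h4 : ((2 : ℝ) ^ i m) ^ (-(3 / 2) : ℝ) ≤ ((m' - m : ℕ) : ℝ) ^ (-(3 / 2) : ℝ) := by
        apply Real.rpow_le_rpow_of_nonpos _ _ (by norm_num)
        · have : 0 < m' - m := by omega
          exact_mod_cast this
        · have a1 := hi2 m'
          have a2 := hi1 m
          rw [← e1] at a1
          rw [Nat.cast_sub hlt.le]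
          linarith
      have h5 := mul_le_mul_of_nonneg_left h4 hc.le
      simp only [η] at h1
      linarith
    intro m m' heq
    rcases lt_trichotomy m m' with h | h | h
    · exact absurd heq (key m m' h)
    · exact h
    · exact absurd heq.symm (key m' m h)
  let C : ℝ := (c / 33) ^ (-(7 / 6) : ℝ)
  let F : ℕ × ℤ → ℝ := fun x => C * (((2 : ℝ) ^ (-(1 / 4) : ℝ)) ^ x.1 * ((|x.2| : ℤ) + 1 : ℝ) ^ (-(7 / 6) : ℝ))
  have hF : Summable F := by
    apply Summable.mul_left
    apply Summable.mul_of_nonneg (f := fun i : ℕ => ((2 : ℝ) ^ (-(1 / 4) : ℝ)) ^ i)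
      (g := fun k : ℤ => ((|k| : ℤ) + 1 : ℝ) ^ (-(7 / 6) : ℝ)) _ summable_g
    · intro i; positivity
    · intro k; positivity
    · apply summable_geometric_of_lt_one (by positivity)
      exact Real.rpow_lt_one_of_one_lt_of_neg (by norm_num) (by norm_num)
  refine Summable.of_nonneg_of_le (fun m => by positivity) ?_ (hF.comp_injective hinj)
  intro m
  have hvpos : 0 < |v m| := lt_of_lt_of_le (by have := hη (i m); positivity) (hvlow m)
  have hv1 : |v m| ≤ 1 := (abs_sub_round _).trans (by norm_num)
  have hcos : |v m| ≤ |Real.cos (Real.pi * (m + 1) * z)| := by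
    have := abs_cos_ge z (m + 1)
    push_cast at this
    have h : |v m| = |vv z (m + 1)| := rfl
    linarith
  have hk : η (i m) * ((|k m| : ℤ) + 1 : ℝ) / 33 ≤ |v m| := by
    have h1 : ((|k m| : ℤ) : ℝ) ≤ |v m| / η (i m) + 1 := by
      have e1 : |v m| / η (i m) = |v m / η (i m)| := by rw [abs_div, abs_of_pos (hη _)]
      rw [e1]
      push_cast
      have a1 := Int.floor_le (v m / η (i m))
      have a2 := Int.lt_floor_add_one (v m / η (i m))
      have a3 := neg_abs_le (v m / η (i m))
      have a4 := le_abs_self (v m / η (i m))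
      change |((⌊v m / η (i m)⌋ : ℤ) : ℝ)| ≤ _
      rw [abs_le]
      constructor <;> linarith
    have h2 : 1 ≤ 16 * (|v m| / η (i m)) := by
      rw [← mul_div_assoc, le_div_iff₀ (hη _)]
      linarith [hvlow m]
    have h3 : ((|k m| : ℤ) + 1 : ℝ) ≤ 33 * (|v m| / η (i m)) := by linarith
    rw [← mul_div_assoc, le_div_iff₀ (hη _)] at h3
    linarith
  have hinv : 1 / |v m| ≤ C * (((2 : ℝ) ^ i m) ^ (7 / 4 : ℝ) * ((|k m| : ℤ) + 1 : ℝ) ^ (-(7 / 6) : ℝ)) := by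
    have h1 : 1 / |v m| ≤ |v m| ^ (-(7 / 6) : ℝ) := by
      rw [one_div, ← Real.rpow_neg_one]
      exact Real.rpow_le_rpow_of_exponent_ge hvpos hv1 (by norm_num)
    have hkp : (0 : ℝ) < (|k m| : ℤ) + 1 := by positivity
    have h2 : |v m| ^ (-(7 / 6) : ℝ) ≤ (η (i m) * ((|k m| : ℤ) + 1 : ℝ) / 33) ^ (-(7 / 6) : ℝ) := by
      apply Real.rpow_le_rpow_of_nonpos _ hk (by norm_num)
      have := hη (i m)
      positivity
    refine h1.trans (h2.trans (le_of_eq ?_))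
    have h3 : η (i m) * ((|k m| : ℤ) + 1 : ℝ) / 33 =
        (c / 33) * (((2 : ℝ) ^ i m) ^ (-(3 / 2) : ℝ) * ((|k m| : ℤ) + 1 : ℝ)) := by
      simp only [η]; ring
    rw [h3, Real.mul_rpow (by positivity) (by positivity), Real.mul_rpow (by positivity) hkp.le,
      ← Real.rpow_mul (by positivity)]
    norm_num [C]
  have hm2 : ((2 : ℝ) ^ i m) ^ 2 ≤ ((m : ℝ) + 1) ^ 2 := pow_le_pow_left₀ (by positivity) (hi1 m) 2
  have hC : 0 ≤ C := by positivity
  calc 1 / |Real.cos (Real.pi * (m + 1) * z)| / ((m : ℝ) + 1) ^ 2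
      ≤ 1 / |v m| / ((2 : ℝ) ^ i m) ^ 2 := by gcongr
    _ ≤ C * (((2 : ℝ) ^ i m) ^ (7 / 4 : ℝ) * ((|k m| : ℤ) + 1 : ℝ) ^ (-(7 / 6) : ℝ)) / ((2 : ℝ) ^ i m) ^ 2 := by
        gcongr
    _ = F (ι m) := by
        simp only [F, ι]
        have h2 : ((2 : ℝ) ^ i m) ^ (7 / 4 : ℝ) / ((2 : ℝ) ^ i m) ^ 2 = ((2 : ℝ) ^ (-(1 / 4) : ℝ)) ^ i m := by
          rw [← Real.rpow_natCast ((2 : ℝ) ^ i m) 2, ← Real.rpow_sub (by positivity),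
            ← Real.rpow_natCast 2 (i m), ← Real.rpow_mul (by norm_num),
            ← Real.rpow_natCast _ (i m), ← Real.rpow_mul (by norm_num)]
          congr 1; push_cast; ring
        rw [← h2]; ring

end RothThm


namespace RothThm

open Filter Topology

noncomputable def aa (k : ℕ) : ℝ := k + 1 / 2

lemma aa_pos (k : ℕ) : 0 < aa k := by unfold aa; positivity

/-- the doubly indexed kernel -/
noncomputable def HH (τ : ℂ) (p : ℕ × ℕ) : ℂ :=
  (-1) ^ p.2 * 2 / (aa p.2 * ((aa p.2) ^ 2 * τ ^ 2 - ((p.1 : ℂ) + 1) ^ 2))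

lemma real_mix {a m D : ℝ} (ha : 0 < a) (hm : 0 < m) (h1 : a ^ 2 ≤ D) (h2 : m ^ 2 ≤ D) :
    a ^ (1 / 2 : ℝ) * m ^ (3 / 2 : ℝ) ≤ D := by
  have key : ∀ x : ℝ, 0 < x → x ^ (1 / 2 : ℝ) * x ^ (3 / 2 : ℝ) = x ^ 2 := by
    intro x hx
    rw [← Real.rpow_add hx]; norm_num
  rcases le_total a m with h | h
  · refine le_trans ?_ h2
    rw [← key m hm]
    gcongr
  · refine le_trans ?_ h1
    rw [← key a ha]
    gcongr

lemma lower_lin (τ : ℂ) (ht : τ.im ≠ 0) : ∃ c : ℝ, 0 < c ∧ ∀ a m : ℝ, 0 < a → 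
    c * a ≤ ‖a * τ + m‖ ∧ c * |m| ≤ ‖a * τ + m‖ := by
  have h0 : 0 < |τ.im| := abs_pos.mpr ht
  have h1 : |τ.im| ≤ ‖τ‖ := Complex.abs_im_le_norm τ
  refine ⟨min |τ.im| (|τ.im| / (|τ.im| + ‖τ‖)), lt_min h0 (by positivity), ?_⟩
  intro a m ha
  have h2 : |τ.im| * a ≤ ‖a * τ + m‖ := by
    have := Complex.abs_im_le_norm (a * τ + m)
    simp [abs_mul, abs_of_pos ha] at this
    linarith
  refine ⟨le_trans ?_ h2, ?_⟩
  · gcongr; exact min_le_left _ _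
  · have h3 : |m| ≤ ‖a * τ + m‖ + a * ‖τ‖ := by
      have := norm_sub_le (a * τ + m) (a * τ)
      simpa [abs_of_pos ha] using this
    calc _ ≤ |τ.im| / (|τ.im| + ‖τ‖) * |m| := by gcongr; exact min_le_right _ _
      _ ≤ _ := by
        rw [div_mul_eq_mul_div, div_le_iff₀ (by positivity)]
        nlinarith [norm_nonneg τ]

lemma summable_HH (τ : ℂ) (ht : τ.im ≠ 0) : Summable (HH τ) := by
  obtain ⟨c, hc, hb⟩ := lower_lin τ ht
  have s1 : Summable (fun m : ℕ => ((m : ℝ) + 1) ^ (-(3 / 2) : ℝ)) := by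
    have := (summable_nat_add_iff 1).mpr (Real.summable_nat_rpow.mpr (show (-(3 / 2) : ℝ) < -1 by norm_num))
    simpa using this
  have s2 : Summable (fun k : ℕ => (aa k) ^ (-(3 / 2) : ℝ)) := by
    have h : Summable (fun k : ℕ => (2 : ℝ) ^ (3 / 2 : ℝ) * ((k : ℝ) + 1) ^ (-(3 / 2) : ℝ)) := s1.mul_left _
    refine Summable.of_nonneg_of_le (fun k => (Real.rpow_pos_of_pos (aa_pos k) _).le) (fun k => ?_) h
    have h1 : ((k : ℝ) + 1) / 2 ≤ aa k := by
      unfold aa; have : (0 : ℝ) ≤ k := k.cast_nonneg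
      linarith
    refine (Real.rpow_le_rpow_of_nonpos (by positivity) h1 (by norm_num)).trans (le_of_eq ?_)
    rw [Real.div_rpow (by positivity) (by norm_num), Real.rpow_neg (show (0:ℝ) ≤ 2 by norm_num)]
    field_simp
  have s3 := ((s1.mul_of_nonneg s2 (fun m => by positivity)
    (fun k => (Real.rpow_pos_of_pos (aa_pos k) _).le)).mul_left (2 / c ^ 2))
  refine Summable.of_norm_bounded s3 ?_
  rintro ⟨m, k⟩
  have ha := aa_pos k
  set a := aa k with hadef
  have hm : (0 : ℝ) < (m : ℝ) + 1 := by positivity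
  have b1 := hb a ((m : ℝ) + 1) ha
  have b2 := hb a (-((m : ℝ) + 1)) ha
  rw [abs_neg] at b2
  rw [abs_of_pos hm] at b1 b2
  have e : ((a : ℂ) ^ 2 * τ ^ 2 - ((m : ℂ) + 1) ^ 2) =
      (a * τ + ((m : ℝ) + 1 : ℝ)) * (a * τ + (-((m : ℝ) + 1) : ℝ)) := by
    push_cast; ring
  have hD : c ^ 2 * (a ^ (1 / 2 : ℝ) * ((m : ℝ) + 1) ^ (3 / 2 : ℝ)) ≤
      ‖((a : ℂ) ^ 2 * τ ^ 2 - ((m : ℂ) + 1) ^ 2)‖ := by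
    rw [e, norm_mul]
    have := real_mix (a := a) (m := (m : ℝ) + 1)
      (D := ‖(a * τ + ((m : ℝ) + 1 : ℝ))‖ * ‖(a * τ + (-((m : ℝ) + 1) : ℝ))‖ / c ^ 2) ha hm
      (by
        rw [le_div_iff₀ (by positivity)]
        have := mul_le_mul b1.1 b2.1 (by positivity) (norm_nonneg _)
        nlinarith)
      (by
        rw [le_div_iff₀ (by positivity)]
        have := mul_le_mul b1.2 b2.2 (by positivity) (norm_nonneg _)
        nlinarith)
    rw [le_div_iff₀ (by positivity)] at this
    linarith
  have hp1 : 0 < a ^ (1 / 2 : ℝ) := Real.rpow_pos_of_pos ha _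
  have hp2 : 0 < ((m : ℝ) + 1) ^ (3 / 2 : ℝ) := Real.rpow_pos_of_pos hm _
  have hn : ‖HH τ (m, k)‖ = 2 / (a * ‖((a : ℂ) ^ 2 * τ ^ 2 - ((m : ℂ) + 1) ^ 2)‖) := by
    simp [HH, ← hadef, abs_of_pos ha]
  rw [hn]
  have hr : 2 / c ^ 2 * (((m : ℝ) + 1) ^ (-(3 / 2) : ℝ) * a ^ (-(3 / 2) : ℝ)) =
      2 / (a * (c ^ 2 * (a ^ (1 / 2 : ℝ) * ((m : ℝ) + 1) ^ (3 / 2 : ℝ)))) := by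
    have : a ^ (3 / 2 : ℝ) = a * a ^ (1 / 2 : ℝ) := by
      rw [show (3 / 2 : ℝ) = 1 + 1 / 2 by norm_num, Real.rpow_add ha, Real.rpow_one]
    rw [Real.rpow_neg ha.le, Real.rpow_neg hm.le, this]
    field_simp
  show _ ≤ 2 / c ^ 2 * (((m : ℝ) + 1) ^ (-(3 / 2) : ℝ) * a ^ (-(3 / 2) : ℝ))
  rw [hr]
  gcongr

/-- Partial fractions of the secant. -/
lemma sec_tendsto (w : ℂ) (hw : w.im ≠ 0) :
    Tendsto (fun N : ℕ => ∑ k ∈ Finset.range (2 * N + 1),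
      (-1 : ℂ) ^ k * (1 / (w + aa k) - 1 / (w - aa k))) atTop
      (𝓝 (Real.pi / Complex.cos (Real.pi * w))) := by
  set x : ℂ := w / 2 + 1 / 4 with hx
  set y : ℂ := w / 2 - 1 / 4 with hy
  have him : ∀ u : ℂ, u.im ≠ 0 → u ∈ Complex.integerComplement := by
    rintro u hu ⟨n, rfl⟩
    simp at hu
  have hxi : x.im ≠ 0 := by
    have : x.im = w.im / 2 := by simp [hx]
    rw [this]; exact div_ne_zero hw two_ne_zero
  have hyi : y.im ≠ 0 := by
    have : y.im = w.im / 2 := by simp [hy]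
    rw [this]; exact div_ne_zero hw two_ne_zero
  have h1 := tendsto_logDeriv_euler_cot_sub (him x hxi)
  have h2 := tendsto_logDeriv_euler_cot_sub (him y hyi)
  have h3 := ((h1.sub h2).const_add (1 / x - 1 / y)).const_mul (1 / 2 : ℂ)
  have hsx := sin_pi_mul_ne_zero (him x hxi)
  have hsy := sin_pi_mul_ne_zero (him y hyi)
  have hlim : (1 / 2 : ℂ) * (1 / x - 1 / y + (Real.pi * Complex.cot (Real.pi * x) - 1 / x -
      (Real.pi * Complex.cot (Real.pi * y) - 1 / y))) = Real.pi / Complex.cos (Real.pi * w) := by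
    have e1 : (Real.pi : ℂ) * y = Real.pi * x - Real.pi / 2 := by rw [hx, hy]; ring
    have e2 : (Real.pi : ℂ) * w = 2 * (Real.pi * x) - Real.pi / 2 := by rw [hx]; ring
    rw [e1] at hsy ⊢
    rw [e2, Complex.cos_sub_pi_div_two, Complex.sin_two_mul, Complex.cot, Complex.cot,
      Complex.cos_sub_pi_div_two, Complex.sin_sub_pi_div_two]
    rw [Complex.sin_sub_pi_div_two] at hsy
    have hc : Complex.cos (Real.pi * x) ≠ 0 := fun h => hsy (by rw [h, neg_zero])
    have hsq := Complex.sin_sq_add_cos_sq (Real.pi * x)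
    generalize Complex.sin (Real.pi * x) = S at hsx hsq ⊢
    generalize Complex.cos (Real.pi * x) = C at hc hsq ⊢
    clear hsy
    field_simp
    linear_combination (Real.pi : ℂ) * hsq
  rw [hlim] at h3
  refine h3.congr (fun N => ?_)
  have hz : ∀ r : ℝ, w + r ≠ 0 := by
    intro r h
    apply hw
    have := congrArg Complex.im h
    simpa using this
  have hx0 : x ≠ 0 := fun h => hxi (by rw [h]; rfl)
  have hy0 : y ≠ 0 := fun h => hyi (by rw [h]; rfl)
  induction N with
  | zero =>
    simp only [Finset.range_zero, Finset.sum_empty, Nat.mul_zero, zero_add, Finset.sum_range_one,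
      pow_zero, aa]
    have e1 : (w + ((0 : ℕ) + 1 / 2 : ℝ)) = 2 * x := by rw [hx]; push_cast; ring
    have e2 : (w - ((0 : ℕ) + 1 / 2 : ℝ)) = 2 * y := by rw [hy]; push_cast; ring
    rw [e1, e2]; field_simp; ring
  | succ N ih =>
    rw [show 2 * (N + 1) + 1 = (2 * N + 1) + 1 + 1 by ring, Finset.sum_range_succ _ (2 * N + 1 + 1),
      Finset.sum_range_succ _ (2 * N + 1), ← ih, Finset.sum_range_succ _ N, Finset.sum_range_succ _ N]
    have p1 : (-1 : ℂ) ^ (2 * N + 1) = -1 := by rw [pow_succ, pow_mul]; simp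
    have p2 : (-1 : ℂ) ^ (2 * N + 1 + 1) = 1 := by rw [pow_succ, p1]; ring
    rw [p1, p2]
    have e1 : w + aa (2 * N + 1) = 2 * (y + (N + 1)) := by rw [hy]; unfold aa; push_cast; ring
    have e2 : w - aa (2 * N + 1) = 2 * (x - (N + 1)) := by rw [hx]; unfold aa; push_cast; ring
    have e3 : w + aa (2 * N + 1 + 1) = 2 * (x + (N + 1)) := by rw [hx]; unfold aa; push_cast; ring
    have e4 : w - aa (2 * N + 1 + 1) = 2 * (y - (N + 1)) := by rw [hy]; unfold aa; push_cast; ring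
    rw [e1, e2, e3, e4]
    have f : ∀ u : ℂ, 1 / (2 * u) = 1 / 2 * (1 / u) := fun u => by rw [one_div_mul_one_div]
    rw [f, f, f, f]
    simp only [cotTerm]
    ring

lemma leib_tendsto : Tendsto (fun N : ℕ => ∑ k ∈ Finset.range (2 * N + 1),
      (-1 : ℂ) ^ k * (2 / aa k)) atTop (𝓝 (Real.pi : ℂ)) := by
  have h := Real.tendsto_sum_pi_div_four.const_mul 4
  have h2 : Tendsto (fun N : ℕ => 2 * N + 1) atTop atTop :=
    tendsto_atTop_mono (fun N => by simp only [id]; omega) tendsto_id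
  have h3 := (Complex.continuous_ofReal.tendsto _).comp (h.comp h2)
  rw [show 4 * (Real.pi / 4) = Real.pi by ring] at h3
  refine h3.congr (fun N => ?_)
  simp only [Function.comp]
  rw [Finset.mul_sum]
  push_cast
  refine Finset.sum_congr rfl (fun k _ => ?_)
  have : (2 * (k : ℂ) + 1) ≠ 0 := by exact_mod_cast (by omega : 2 * k + 1 ≠ 0)
  have e : (aa k : ℂ) = (2 * k + 1) / 2 := by unfold aa; push_cast; ring
  rw [e]; field_simp; norm_num

lemma row_sum (τ : ℂ) (ht : τ.im ≠ 0) (m : ℕ) :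
    ∑' k, HH τ (m, k) = Real.pi * ((1 / Complex.cos (Real.pi * (((m : ℂ) + 1) / τ)) - 1) /
      ((m : ℂ) + 1) ^ 2) := by
  have hs : Summable (fun k => HH τ (m, k)) := (summable_HH τ ht).prod_factor m
  have hτ : τ ≠ 0 := fun h => ht (by rw [h]; rfl)
  have hm : ((m : ℂ) + 1) ≠ 0 := by exact_mod_cast (by omega : m + 1 ≠ 0)
  set w : ℂ := ((m : ℂ) + 1) / τ with hw
  have hwi : w.im ≠ 0 := by
    intro h
    apply ht
    obtain ⟨r, hr⟩ : ∃ r : ℝ, w = r := ⟨w.re, by apply Complex.ext <;> simp [h]⟩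
    have : τ = (((m : ℝ) + 1) / r : ℝ) := by
      have hr0 : (r : ℂ) ≠ 0 := by rw [← hr, hw]; exact div_ne_zero hm hτ
      push_cast
      rw [eq_div_iff hr0, ← hr, hw]; field_simp
    rw [this]; simp
  have h1 := ((sec_tendsto w hwi).sub leib_tendsto).const_mul (1 / ((m : ℂ) + 1) ^ 2)
  have h2 : Tendsto (fun N : ℕ => 2 * N + 1) atTop atTop :=
    tendsto_atTop_mono (fun N => by simp only [id]; omega) tendsto_id
  have h3 := hs.hasSum.tendsto_sum_nat.comp h2
  refine tendsto_nhds_unique h3 ?_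
  convert h1 using 1
  · funext N
    simp only [Function.comp]
    rw [← Finset.sum_sub_distrib, Finset.mul_sum]
    refine Finset.sum_congr rfl (fun k _ => ?_)
    have hz : ∀ r : ℝ, w + r ≠ 0 := by
      intro r h
      apply hwi
      have := congrArg Complex.im h
      simpa using this
    have z1 := hz (aa k)
    have z2 : w - aa k ≠ 0 := by have := hz (-aa k); rwa [Complex.ofReal_neg, ← sub_eq_add_neg] at this
    have ha : (aa k : ℂ) ≠ 0 := by exact_mod_cast (aa_pos k).ne'
    have e : (m : ℂ) + 1 = w * τ := by rw [hw]; field_simp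
    have hw0 : w ≠ 0 := by rw [hw]; exact div_ne_zero hm hτ
    simp only [HH]
    rw [e]
    have e2 : ((aa k : ℂ) ^ 2 * τ ^ 2 - (w * τ) ^ 2) = -(τ ^ 2 * (w + aa k) * (w - aa k)) := by ring
    rw [e2]
    field_simp
    ring
  · congr 1; ring

lemma col_sum (τ : ℂ) (ht : τ.im ≠ 0) (k : ℕ) :
    τ * ∑' m, HH τ (m, k) = (-1) ^ k * (Real.pi * Complex.cot (Real.pi * (aa k * τ)) / (aa k) ^ 2) -
      (-1) ^ k / (aa k) ^ 3 * (1 / τ) := by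
  have hτ : τ ≠ 0 := fun h => ht (by rw [h]; rfl)
  have ha : (aa k : ℂ) ≠ 0 := by exact_mod_cast (aa_pos k).ne'
  have hxi : (aa k * τ).im ≠ 0 := by
    simpa using ⟨(aa_pos k).ne', ht⟩
  have hx : (aa k * τ) ∈ Complex.integerComplement := by
    rintro ⟨n, h⟩
    rw [← h] at hxi
    simp at hxi
  have h := cot_series_rep' hx
  have e : ∀ m : ℕ, HH τ (m, k) = (-1) ^ k / (aa k * (aa k * τ)) *
      (1 / (aa k * τ - (m + 1)) + 1 / (aa k * τ + (m + 1))) := by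
    intro m
    have hz : ∀ r : ℝ, aa k * τ + r ≠ 0 := by
      intro r h
      apply hxi
      have := congrArg Complex.im h
      simpa using this
    have z1 : aa k * τ + (m + 1) ≠ 0 := by have := hz (m + 1); push_cast at this; exact this
    have z2 : aa k * τ - (m + 1) ≠ 0 := by
      have := hz (-(m + 1)); push_cast at this; rw [sub_eq_add_neg]; exact this
    simp only [HH]
    rw [show ((aa k : ℂ) ^ 2 * τ ^ 2 - ((m : ℂ) + 1) ^ 2) =
      (aa k * τ - (m + 1)) * (aa k * τ + (m + 1)) by ring]
    field_simp
    ring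
  simp_rw [e]
  rw [tsum_mul_left, ← h]
  field_simp

lemma cube_sum : HasSum (fun k : ℕ => (-1 : ℂ) ^ k / (aa k) ^ 3) ((Real.pi : ℂ) ^ 3 / 4) := by
  have h := hasSum_L_function_mod_four_eval_three
  have inj : Function.Injective (fun k : ℕ => 2 * k + 1) := fun a b h => by simpa using h
  have h2 := (inj.hasSum_iff (f := fun n : ℕ => (1 : ℝ) / (n : ℝ) ^ 3 * Real.sin (Real.pi * n / 2))
    (a := Real.pi ^ 3 / 32) (by
      intro n hn
      have he : Even n := by
        by_contra ho
        rw [Nat.not_even_iff_odd] at ho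
        obtain ⟨j, hj⟩ := ho
        exact hn ⟨j, hj.symm⟩
      obtain ⟨j, hj⟩ := he
      have : Real.pi * n / 2 = j * Real.pi := by rw [hj]; push_cast; ring
      rw [this, Real.sin_nat_mul_pi, mul_zero])).mpr h
  have h3 := (Complex.hasSum_ofReal.mpr (h2.mul_left 8))
  convert h3 using 1
  · funext k
    simp only [Function.comp]
    have : Real.sin (Real.pi * ((2 * k + 1 : ℕ) : ℝ) / 2) = (-1) ^ k := by
      rw [show Real.pi * ((2 * k + 1 : ℕ) : ℝ) / 2 = Real.pi / 2 + k * Real.pi by push_cast; ring,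
        Real.sin_add_nat_mul_pi, Real.sin_pi_div_two, mul_one]
    rw [this]
    have h4 : (2 * (k : ℂ) + 1) ≠ 0 := by exact_mod_cast (by omega : 2 * k + 1 ≠ 0)
    have e : (aa k : ℂ) = (2 * k + 1) / 2 := by unfold aa; push_cast; ring
    rw [e]; push_cast; field_simp
    try norm_num
  · push_cast; ring

noncomputable def psi0 (τ : ℂ) : ℂ :=
  ∑' m : ℕ, (1 / Complex.cos (Real.pi * (((m : ℂ) + 1) / τ)) - 1) / ((m : ℂ) + 1) ^ 2

lemma cot_period (n : ℤ) (τ : ℂ) (k : ℕ) :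
    Complex.cot (Real.pi * (aa k * (τ + 2 * n))) = Complex.cot (Real.pi * (aa k * τ)) := by
  have e : (Real.pi : ℂ) * (aa k * (τ + 2 * n)) = Real.pi * (aa k * τ) +
      (((2 * k + 1) * n : ℤ) : ℂ) * Real.pi := by
    unfold aa; push_cast; ring
  rw [e, Complex.cot, Complex.cot, Complex.sin_antiperiodic.add_int_mul_eq,
    Complex.cos_antiperiodic.add_int_mul_eq, mul_div_mul_left]
  simp

theorem psi0_eq (n : ℤ) (τ : ℂ) (ht : τ.im ≠ 0) :
    (τ + 2 * n) * psi0 (τ + 2 * n) - τ * psi0 τ =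
      (Real.pi : ℂ) ^ 2 / 4 * (1 / τ - 1 / (τ + 2 * n)) := by
  have ht' : (τ + 2 * n).im ≠ 0 := by simpa using ht
  have key : ∀ τ : ℂ, τ.im ≠ 0 → HasSum (fun k : ℕ =>
      (-1) ^ k * (Real.pi * Complex.cot (Real.pi * (aa k * τ)) / (aa k) ^ 2) -
      (-1) ^ k / (aa k) ^ 3 * (1 / τ)) (τ * (Real.pi * psi0 τ)) := by
    intro τ ht
    have hs := summable_HH τ ht
    have h1 : Real.pi * psi0 τ = ∑' k, ∑' m, HH τ (m, k) := by
      rw [psi0, ← tsum_mul_left]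
      simp_rw [← row_sum τ ht]
      exact (Summable.tsum_comm (f := fun m k => HH τ (m, k)) hs).symm
    have h2 : Summable (fun k => ∑' m, HH τ (m, k)) := hs.prod_symm.prod
    have h3 := h2.hasSum.mul_left τ
    rw [← h1] at h3
    simpa only [col_sum τ ht] using h3
  have k1 := key _ ht'
  have k2 := key _ ht
  simp only [cot_period] at k1
  have k3 := k1.sub k2
  have k4 := cube_sum.mul_right (1 / τ - 1 / (τ + 2 * n))
  have k6 : ∀ k : ℕ, (-1 : ℂ) ^ k * (Real.pi * Complex.cot (Real.pi * (aa k * τ)) / (aa k) ^ 2) -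
      (-1) ^ k / (aa k) ^ 3 * (1 / (τ + 2 * n)) -
      ((-1) ^ k * (Real.pi * Complex.cot (Real.pi * (aa k * τ)) / (aa k) ^ 2) -
      (-1) ^ k / (aa k) ^ 3 * (1 / τ)) = (-1 : ℂ) ^ k / (aa k) ^ 3 * (1 / τ - 1 / (τ + 2 * n)) :=
    fun k => by ring
  simp only [k6] at k3
  have k5 := k3.unique k4
  have hpi : (Real.pi : ℂ) ≠ 0 := by exact_mod_cast Real.pi_ne_zero
  apply mul_left_cancel₀ hpi
  linear_combination k5

lemma summable_psi0 (τ : ℂ) (ht : τ.im ≠ 0) : Summable (fun m : ℕ =>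
    (1 / Complex.cos (Real.pi * (((m : ℂ) + 1) / τ)) - 1) / ((m : ℂ) + 1) ^ 2) := by
  have h := (summable_HH τ ht).prod
  simp_rw [row_sum τ ht] at h
  have hpi : (Real.pi : ℂ) ≠ 0 := by exact_mod_cast Real.pi_ne_zero
  exact (summable_mul_left_iff hpi).mp h

lemma zeta2 : HasSum (fun m : ℕ => 1 / ((m : ℂ) + 1) ^ 2) ((Real.pi : ℂ) ^ 2 / 6) := by
  have h := (hasSum_nat_add_iff' 1).mpr hasSum_zeta_two
  have h2 := Complex.hasSum_ofReal.mpr h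
  convert h2 using 1
  · funext m; push_cast; rfl
  · simp

/-- the functional equation off the real axis -/
theorem psi_complex (n : ℤ) (z : ℂ) (hz : z.im ≠ 0) :
    ∑' m : ℕ, 1 / Complex.cos (Real.pi * ((m : ℂ) + 1) * (z / (2 * n * z + 1))) / ((m : ℂ) + 1) ^ 2 =
      (1 / (2 * n * z + 1)) *
          (∑' m : ℕ, 1 / Complex.cos (Real.pi * ((m : ℂ) + 1) * z) / ((m : ℂ) + 1) ^ 2) +
        ((n : ℂ) * z * (3 * z ^ 2 + 4 * n * z + 2) / (2 * n * z + 1) ^ 2) * ((Real.pi : ℂ) ^ 2 / 6) := by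
  have hz0 : z ≠ 0 := fun h => hz (by rw [h]; rfl)
  set τ : ℂ := 1 / z with hτ
  have ht : τ.im ≠ 0 := by
    rw [hτ, one_div, Complex.inv_im]
    exact div_ne_zero (neg_ne_zero.mpr hz) (by simpa using hz0)
  have ht' : (τ + 2 * n).im ≠ 0 := by simpa using ht
  have hd : 2 * n * z + 1 ≠ 0 := by
    intro h
    have h1 : τ + 2 * n = 0 := by
      rw [hτ]; field_simp; linear_combination h
    exact ht' (by rw [h1]; rfl)
  have key : ∀ τ : ℂ, τ.im ≠ 0 → ∀ u : ℂ, u = 1 / τ →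
      ∑' m : ℕ, 1 / Complex.cos (Real.pi * ((m : ℂ) + 1) * u) / ((m : ℂ) + 1) ^ 2 =
        psi0 τ + (Real.pi : ℂ) ^ 2 / 6 := by
    intro τ ht u hu
    have h := (summable_psi0 τ ht).hasSum.add zeta2
    refine (tsum_congr fun m => ?_).trans h.tsum_eq
    rw [hu, show (Real.pi : ℂ) * (m + 1) * (1 / τ) = Real.pi * ((m + 1) / τ) by ring]
    ring
  rw [key (τ + 2 * n) ht' _ (by rw [hτ]; field_simp; ring), key τ ht z (by rw [hτ]; field_simp)]
  have h := psi0_eq n τ ht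
  have e1 : τ + 2 * n = (2 * n * z + 1) / z := by rw [hτ]; field_simp; ring
  have h2 : psi0 (τ + 2 * n) = z / (2 * n * z + 1) * (τ * psi0 τ +
      (Real.pi : ℂ) ^ 2 / 4 * (1 / τ - 1 / (τ + 2 * n))) := by
    rw [← h]; nth_rewrite 2 [e1]; field_simp; ring
  rw [h2, e1, hτ]
  clear h2 h e1 key ht ht'
  obtain ⟨D, hD⟩ : ∃ D : ℂ, D = 2 * n * z + 1 := ⟨_, rfl⟩
  have hn : (n : ℂ) = (D - 1) / (2 * z) := by rw [hD]; field_simp; ring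
  rw [← hD] at hd ⊢
  rw [hn]
  field_simp
  ring

end RothThm


namespace RothThm

open Filter Topology

lemma cos_bounds (a b : ℝ) : |Real.cos a| ≤ ‖Complex.cos (a + b * Complex.I)‖ ∧
    |b| ≤ ‖Complex.cos (a + b * Complex.I)‖ := by
  have h : ‖Complex.cos (a + b * Complex.I)‖ ^ 2 = Real.cos a ^ 2 + Real.sinh b ^ 2 := by
    have e : Complex.cos (a + b * Complex.I) =
        ((Real.cos a * Real.cosh b : ℝ) : ℂ) + ((-(Real.sin a * Real.sinh b) : ℝ) : ℂ) * Complex.I := by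
      rw [Complex.cos_add_mul_I]; push_cast; ring
    rw [e, ← Complex.normSq_eq_norm_sq, Complex.normSq_add_mul_I]
    have h1 := Real.cosh_sq b
    have h2 := Real.sin_sq_add_cos_sq a
    rw [mul_pow, h1, neg_sq, mul_pow]
    linear_combination (Real.sinh b ^ 2) * h2
  have hs : b ^ 2 ≤ Real.sinh b ^ 2 := by
    rw [sq_le_sq]
    rcases le_total 0 b with hb | hb
    · rw [abs_of_nonneg hb, abs_of_nonneg (Real.sinh_nonneg_iff.mpr hb)]
      exact Real.self_le_sinh_iff.mpr hb
    · rw [abs_of_nonpos hb, abs_of_nonpos (Real.sinh_nonpos_iff.mpr hb)]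
      exact neg_le_neg (Real.sinh_le_self_iff.mpr hb)
  constructor
  · refine abs_le_of_sq_le_sq ?_ (norm_nonneg _)
    nlinarith [sq_nonneg (Real.sinh b)]
  · refine abs_le_of_sq_le_sq ?_ (norm_nonneg _)
    nlinarith [sq_nonneg (Real.cos a)]

lemma cos_ne (x : ℝ) (hirr : Irrational x) (m : ℕ) : Real.cos (Real.pi * (m + 1) * x) ≠ 0 := by
  intro h
  rw [Real.cos_eq_zero_iff] at h
  obtain ⟨k, hk⟩ := h
  have h1 : ((2 * (m + 1) : ℕ) : ℝ) * x = ((2 * k + 1 : ℤ) : ℝ) := by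
    have := Real.pi_pos
    push_cast
    field_simp at hk
    linarith
  exact (hirr.natCast_mul (by omega : 2 * (m + 1) ≠ 0)).ne_int _ h1

lemma limit_lemma (x : ℝ) (hα : IsAlgebraic ℤ x) (hirr : Irrational x) {l : Filter ℝ}
    (u : ℝ → ℂ) (hu : Tendsto u l (𝓝 (x : ℂ))) (C : ℝ) (hC : 0 ≤ C)
    (hb : ∀ᶠ y in l, ‖u y - x‖ ≤ C * |(u y).im|) :
    Tendsto (fun y => ∑' m : ℕ, 1 / Complex.cos (Real.pi * ((m : ℂ) + 1) * u y) / ((m : ℂ) + 1) ^ 2) l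
      (𝓝 ((∑' m : ℕ, 1 / Real.cos (Real.pi * (m + 1) * x) / ((m : ℝ) + 1) ^ 2 : ℝ) : ℂ)) := by
  rw [Complex.ofReal_tsum]
  refine tendsto_tsum_of_dominated_convergence
    (bound := fun m : ℕ => (1 + C) * (1 / |Real.cos (Real.pi * (m + 1) * x)| / ((m : ℝ) + 1) ^ 2))
    ((summable_sec x hα hirr).mul_left _) ?_ ?_
  · intro m
    push_cast
    have hne : Complex.cos (Real.pi * ((m : ℂ) + 1) * x) ≠ 0 := by
      have := cos_ne x hirr m
      exact_mod_cast (Complex.ofReal_ne_zero.mpr this)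
    refine Tendsto.div_const ?_ _
    refine Tendsto.div tendsto_const_nhds ?_ hne
    exact (Complex.continuous_cos.tendsto _).comp (hu.const_mul _)
  · filter_upwards [hb] with y hy m
    have hM : (0 : ℝ) < (m : ℝ) + 1 := by positivity
    have hMC : ‖(m : ℂ) + 1‖ = (m : ℝ) + 1 := by
      have : (m : ℂ) + 1 = (((m : ℝ) + 1 : ℝ) : ℂ) := by push_cast; rfl
      rw [this, Complex.norm_real, Real.norm_of_nonneg hM.le]
    have hpos : 0 < |Real.cos (Real.pi * (m + 1) * x)| := abs_pos.mpr (cos_ne x hirr m)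
    have e : (Real.pi : ℂ) * ((m : ℂ) + 1) * u y =
        ((Real.pi * (m + 1) * (u y).re : ℝ) : ℂ) + ((Real.pi * (m + 1) * (u y).im : ℝ) : ℂ) * Complex.I := by
      nth_rewrite 1 [← Complex.re_add_im (u y)]
      push_cast; ring
    have hcb := cos_bounds (Real.pi * (m + 1) * (u y).re) (Real.pi * (m + 1) * (u y).im)
    rw [← e] at hcb
    set N := ‖Complex.cos ((Real.pi : ℂ) * ((m : ℂ) + 1) * u y)‖ with hN
    have h1 : |Real.cos (Real.pi * (m + 1) * x)| ≤ (1 + C) * N := by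
      have h2 := Real.abs_cos_sub_cos_le (Real.pi * (m + 1) * x) (Real.pi * (m + 1) * (u y).re)
      have h3 : |x - (u y).re| ≤ C * |(u y).im| := by
        refine le_trans ?_ hy
        have := Complex.abs_re_le_norm (u y - x)
        rw [abs_sub_comm]
        simpa using this
      have h4 : |Real.pi * (m + 1) * x - Real.pi * (m + 1) * (u y).re| =
          Real.pi * (m + 1) * |x - (u y).re| := by
        rw [← mul_sub, abs_mul, abs_of_pos (mul_pos Real.pi_pos hM)]
      have h5 : |Real.pi * (m + 1) * (u y).im| = Real.pi * (m + 1) * |(u y).im| := by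
        rw [abs_mul, abs_of_pos (mul_pos Real.pi_pos hM)]
      rw [h4] at h2
      rw [h5] at hcb
      have h6 := abs_sub_abs_le_abs_sub (Real.cos (Real.pi * (m + 1) * x))
        (Real.cos (Real.pi * (m + 1) * (u y).re))
      have h7 := mul_le_mul_of_nonneg_left h3 (mul_pos Real.pi_pos hM).le
      have h8 := mul_le_mul_of_nonneg_left hcb.2 hC
      have h9 := hcb.1
      nlinarith
    have hNpos : 0 < N := by
      have : 0 < (1 + C) * N := hpos.trans_le h1
      exact pos_of_mul_pos_right this (by positivity)
    rw [norm_div, norm_div, norm_pow, hMC, norm_one, ← hN, ← mul_div_assoc]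
    gcongr
    rw [mul_one_div, div_le_div_iff₀ hNpos hpos, one_mul]
    exact h1

theorem main_real (n : ℤ) (z : ℝ)
    (hirr : Irrational z) (halg : IsAlgebraic ℚ z) (hden : 2 * (n : ℝ) * z + 1 ≠ 0) :
    ∑' m : ℕ, 1 / Real.cos (Real.pi * (m + 1) * (z / (2 * n * z + 1))) / ((m : ℝ) + 1) ^ 2 =
      (1 / (2 * n * z + 1)) *
          (∑' m : ℕ, 1 / Real.cos (Real.pi * (m + 1) * z) / ((m : ℝ) + 1) ^ 2) +
        ((n : ℝ) * z * (3 * z ^ 2 + 4 * n * z + 2) / (2 * n * z + 1) ^ 2) * (Real.pi ^ 2 / 6) := by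
  have hz0 : z ≠ 0 := hirr.ne_zero
  set D : ℝ := 2 * n * z + 1 with hD
  have hirr' : Irrational (z / D) := by
    have h1 : Irrational (z⁻¹ + ((2 * n : ℤ) : ℝ)) := (irrational_inv_iff.mpr hirr).add_intCast _
    have h2 := irrational_inv_iff.mpr h1
    have : (z⁻¹ + ((2 * n : ℤ) : ℝ))⁻¹ = z / D := by
      rw [inv_eq_iff_eq_inv, inv_div, hD]; push_cast; field_simp; ring
    rwa [this] at h2
  have halg' : IsAlgebraic ℚ (z / D) := by
    have hDa : IsAlgebraic ℚ D := by
      have h1 := ((isAlgebraic_algebraMap (R := ℚ) (A := ℝ) (2 * n : ℚ)).mul halg).add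
        (isAlgebraic_algebraMap (R := ℚ) (A := ℝ) (1 : ℚ))
      simpa [hD] using h1
    rw [div_eq_mul_inv]
    exact halg.mul hDa.inv
  have hA : IsAlgebraic ℤ z := (IsFractionRing.isAlgebraic_iff ℤ ℚ ℝ).mpr halg
  have hA' : IsAlgebraic ℤ (z / D) := (IsFractionRing.isAlgebraic_iff ℤ ℚ ℝ).mpr halg'
  let l : Filter ℝ := 𝓝[>] 0
  let w : ℝ → ℂ := fun y => z + y * Complex.I
  have hw : Tendsto w l (𝓝 (z : ℂ)) := by
    have : Continuous w := by fun_prop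
    have h := (this.tendsto 0).mono_left (nhdsWithin_le_nhds (s := Set.Ioi 0))
    simpa [w] using h
  have hDc : (2 * n * (z : ℂ) + 1) = (D : ℂ) := by rw [hD]; push_cast; rfl
  have hDC : (2 * n * (z : ℂ) + 1) ≠ 0 := by rw [hDc]; exact_mod_cast hden
  have hwD : Tendsto (fun y => 2 * n * w y + 1) l (𝓝 (2 * n * (z : ℂ) + 1)) :=
    (hw.const_mul _).add_const 1
  have hpos : ∀ᶠ y in l, (0 : ℝ) < y := eventually_mem_nhdsWithin
  have L1 := limit_lemma z hA hirr w hw 1 zero_le_one (by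
    filter_upwards [hpos] with y hy
    simp [w])
  have L2 := limit_lemma (z / D) hA' hirr' (fun y => w y / (2 * n * w y + 1)) (by
      have := hw.div hwD hDC
      rw [hDc] at this
      push_cast
      exact this) 2 (by norm_num) (by
    have hev : ∀ᶠ y in l, ‖2 * n * w y + 1‖ < 2 * ‖(2 * n * (z : ℂ) + 1)‖ := by
      refine hwD.norm.eventually_lt_const ?_
      have := norm_pos_iff.mpr hDC
      linarith
    filter_upwards [hpos, hev] with y hy hlt
    have hDy : (2 * n * w y + 1) = (D : ℂ) + ((2 * n * y : ℝ) : ℂ) * Complex.I := by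
      rw [hD]; simp only [w]; push_cast; ring
    have hDy0 : (2 * n * w y + 1) ≠ 0 := by
      intro h
      rw [hDy] at h
      have := congrArg Complex.re h
      simp at this
      exact hden this
    have hDD : (D : ℂ) ≠ 0 := by exact_mod_cast hden
    have e1 : w y / (2 * n * w y + 1) - ((z / D : ℝ) : ℂ) = y * Complex.I / (D * (2 * n * w y + 1)) := by
      push_cast
      rw [div_sub_div _ _ hDy0 hDD, mul_comm (D : ℂ) (2 * n * w y + 1)]
      congr 1
      rw [← hDc]; simp only [w]; ring
    have e2 : (w y / (2 * n * w y + 1)).im = y / ‖2 * n * w y + 1‖ ^ 2 := by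
      rw [Complex.div_im, ← Complex.normSq_eq_norm_sq]
      have i1 : (w y).im = y := by simp [w]
      have i2 : (w y).re = z := by simp [w]
      have i3 : (2 * n * w y + 1).re = D := by rw [hDy]; simp
      have i4 : (2 * n * w y + 1).im = 2 * n * y := by rw [hDy]; simp
      rw [i1, i2, i3, i4, ← sub_div]
      congr 1
      rw [hD]; ring
    rw [e1, e2, norm_div, norm_mul, norm_mul, Complex.norm_I, Complex.norm_real, mul_one,
      Real.norm_of_nonneg hy.le, ← hDc]
    have p1 : 0 < ‖2 * n * w y + 1‖ := norm_pos_iff.mpr hDy0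
    have p2 : 0 < ‖(2 * n * (z : ℂ) + 1)‖ := norm_pos_iff.mpr hDC
    rw [abs_of_pos (by positivity), ← mul_div_assoc, div_le_div_iff₀ (by positivity) (by positivity)]
    have := mul_le_mul_of_nonneg_left hlt.le (mul_pos hy p1).le
    nlinarith)
  have L3 : Tendsto (fun y => (1 / (2 * n * w y + 1)) *
          (∑' m : ℕ, 1 / Complex.cos (Real.pi * ((m : ℂ) + 1) * w y) / ((m : ℂ) + 1) ^ 2) +
        ((n : ℂ) * w y * (3 * w y ^ 2 + 4 * n * w y + 2) / (2 * n * w y + 1) ^ 2) *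
          ((Real.pi : ℂ) ^ 2 / 6)) l
      (𝓝 ((1 / (2 * n * (z : ℂ) + 1)) *
          ((∑' m : ℕ, 1 / Real.cos (Real.pi * (m + 1) * z) / ((m : ℝ) + 1) ^ 2 : ℝ) : ℂ) +
        ((n : ℂ) * z * (3 * z ^ 2 + 4 * n * z + 2) / (2 * n * z + 1) ^ 2) *
          ((Real.pi : ℂ) ^ 2 / 6))) := by
    refine ((tendsto_const_nhds.div hwD hDC).mul L1).add (Tendsto.mul_const _ ?_)
    refine Tendsto.div ?_ (hwD.pow 2) (pow_ne_zero 2 hDC)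
    have hc : Continuous (fun t : ℂ => (n : ℂ) * t * (3 * t ^ 2 + 4 * n * t + 2)) := by fun_prop
    exact (hc.tendsto _).comp hw
  have heq := L2.congr' (by
    filter_upwards [hpos] with y hy
    exact psi_complex n (w y) (by simpa [w] using hy.ne'))
  have := tendsto_nhds_unique heq L3
  rw [hDc] at this
  exact_mod_cast this

end RothThm

open Real

theorem secant_zeta_two_iterated_transformation (n : ℤ) (hn : n ≠ 0) (z : ℝ)
    (hirr : Irrational z) (halg : IsAlgebraic ℚ z) (hden : 2 * (n : ℝ) * z + 1 ≠ 0) :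
    ∑' m : ℕ, 1 / Real.cos (π * (m + 1) * (z / (2 * n * z + 1))) / ((m : ℝ) + 1) ^ 2 =
      (1 / (2 * n * z + 1)) *
          (∑' m : ℕ, 1 / Real.cos (π * (m + 1) * z) / ((m : ℝ) + 1) ^ 2) +
        ((n : ℝ) * z * (3 * z ^ 2 + 4 * n * z + 2) / (2 * n * z + 1) ^ 2) * (π ^ 2 / 6) := by
  exact RothThm.main_real n z hirr halg hden
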